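/- arXiv:2507.08090 — 6 statements merged into one kernel-verified Lean document; each statement's English description precedes it below -/
import Mathlib

section
/- Let f₁,…,f_k ∈ ℂ[x₀,…,x_N] be homogeneous polynomials with deg f₁ ≥ deg f₂ ≥ ⋯ ≥ deg f_k, and assume that at every point a ∈ ℂ^{N+1} ∖ {0} with f₁(a) = ⋯ = f_k(a) = 0 the k × (N+1) Jacobian matrix (∂f_s/∂x_t(a)) has rank k (i.e., X = V(f₁,…,f_k) ⊂ ℙ^N is a smooth complete intersection of codimension k). Then there exist homogeneous polynomials h_{ij} ∈ ℂ[x₀,…,x_N] of degree deg f_i − deg f_j, for 1 ≤ i < j ≤ k, such that, setting g_i = f_i + Σ_{j=i+1}^{k} h_{ij} f_j, the following hold: (a) the ideals (g₁,…,g_k) and (f₁,…,f_k) of ℂ[x₀,…,x_N] coincide; and (b) for every i = 1,…,k and every point a ∈ ℂ^{N+1} ∖ {0} with g₁(a) = ⋯ = g_i(a) = 0, the i × (N+1) Jacobian matrix (∂g_s/∂x_t(a))_{1 ≤ s ≤ i} has rank i (i.e., each V(g₁,…,g_i) ⊂ ℙ^N is a smooth complete intersection of codimension i). -/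
open MvPolynomial

open scoped IntermediateField.algebraAdjoinAdjoin in
theorem exists_deriv_aux {K L ι : Type} [Field K] [CharZero K] [Field L] [Algebra K L]
    (x : ι → L) (hx : IsTranscendenceBasis K x) [DecidableEq ι] (b : ι) :
    ∃ D : Derivation K L L, ∀ b', D (x b') = if b' = b then 1 else 0 := by
  have h1 : Algebra.FormallyEtale (Algebra.adjoin K (Set.range x))
      (IntermediateField.adjoin K (Set.range x)) :=
    .of_isLocalization (nonZeroDivisors _)
  have h2 := hx.isAlgebraic_field
  have h3 : Algebra.FormallyEtale (IntermediateField.adjoin K (Set.range x)) L :=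
    Algebra.FormallyEtale.of_isSeparable _ L
  have h4 : Algebra.FormallyEtale (Algebra.adjoin K (Set.range x)) L :=
    .comp _ (IntermediateField.adjoin K (Set.range x)) _
  let e := hx.1.aevalEquiv
  have he : ∀ a, aeval x (e.symm a) = (a : L) := by
    intro a
    have := hx.1.algebraMap_aevalEquiv (e.symm a)
    rw [← this]
    simp [e]
  let D0 : Derivation K (Algebra.adjoin K (Set.range x)) L :=
    Derivation.mk' ((aeval x).toLinearMap ∘ₗ (pderiv b).toLinearMap ∘ₗ e.symm.toLinearMap) (by
      intro a c
      simp [he, Algebra.smul_def])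
  let l := D0.liftKaehlerDifferential.liftBaseChange L
  let φ := KaehlerDifferential.tensorKaehlerEquivOfFormallyEtale K
    (Algebra.adjoin K (Set.range x)) L
  refine ⟨(l ∘ₗ φ.symm.toLinearMap).compDer (KaehlerDifferential.D K L), ?_⟩
  intro b'
  have hb : x b' = algebraMap (Algebra.adjoin K (Set.range x)) L (e (X b')) := by
    rw [hx.1.algebraMap_aevalEquiv]; simp
  have : φ.symm (KaehlerDifferential.D K L (x b')) = 1 ⊗ₜ KaehlerDifferential.D K _ (e (X b')) := by
    rw [hb]
    exact KaehlerDifferential.tensorKaehlerEquivOfFormallyEtale_symm_D_algebraMap _ _ _ _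
  change l (φ.symm (KaehlerDifferential.D K L (x b'))) = _
  rw [this]
  simp only [l, LinearMap.liftBaseChange_tmul, Derivation.liftKaehlerDifferential_comp_D, one_smul]
  simp [D0, pderiv_X, Pi.single_apply]

theorem exists_deriv (S : Set ℂ) (hS : S.Finite) (ι : Type) [Finite ι] [DecidableEq ι] :
    ∃ p : ι → ℂ, ∀ l, ∃ D : Derivation ℤ ℂ ℂ, (∀ s ∈ S, D s = 0) ∧
      ∀ l', D (p l') = if l' = l then 1 else 0 := by
  classical
  have hc : Cardinal.mk (IntermediateField.adjoin ℚ S) ≤ Cardinal.aleph0 := by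
    have h := IntermediateField.lift_cardinalMk_adjoin_le ℚ S
    have : Countable S := hS.countable.to_subtype
    simpa using h
  obtain ⟨B, x, hx⟩ := exists_isTranscendenceBasis' (IntermediateField.adjoin ℚ S) ℂ
  have hB : Infinite B := by
    have h := IsAlgClosed.cardinal_eq_cardinal_transcendence_basis_of_aleph0_lt x hx hc
      (by simp [Cardinal.mk_complex, Cardinal.aleph0_lt_continuum])
    rw [Cardinal.infinite_iff]
    simp only [Cardinal.lift_id] at h
    rw [← h, Cardinal.mk_complex]
    exact Cardinal.aleph0_le_continuum
  have := Fintype.ofFinite ι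
  obtain ⟨n, ⟨en⟩⟩ := Finite.exists_equiv_fin ι
  let j : ι → B := fun i => Infinite.natEmbedding B (en i)
  have hj : Function.Injective j := fun a b h => by
    simpa [j, Fin.val_inj] using h
  refine ⟨x ∘ j, fun l => ?_⟩
  obtain ⟨D, hD⟩ := exists_deriv_aux x hx (j l)
  refine ⟨D.restrictScalars ℤ, ?_, ?_⟩
  · intro s hs
    exact D.map_algebraMap (⟨s, IntermediateField.subset_adjoin ℚ S hs⟩ : IntermediateField.adjoin ℚ S)
  · intro l'
    have := hD (j l')
    simpa [hj.eq_iff] using this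

/-- the coefficientwise part of a derivation, at a point -/
noncomputable def TT {n : ℕ} (D : Derivation ℤ ℂ ℂ) (a : Fin n → ℂ) (q : MvPolynomial (Fin n) ℂ) : ℂ :=
  D (eval a q) - ∑ t, eval a (pderiv t q) * D (a t)

theorem TT_add {n : ℕ} (D : Derivation ℤ ℂ ℂ) (a : Fin n → ℂ) (q r) :
    TT D a (q + r) = TT D a q + TT D a r := by
  simp [TT, add_mul, Finset.sum_add_distrib]; ring

theorem TT_sum {n : ℕ} (D : Derivation ℤ ℂ ℂ) (a : Fin n → ℂ) {α : Type} (s : Finset α)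
    (q : α → MvPolynomial (Fin n) ℂ) :
    TT D a (∑ i ∈ s, q i) = ∑ i ∈ s, TT D a (q i) := by
  classical
  induction s using Finset.induction_on with
  | empty => simp [TT]
  | insert i s hi ih => rw [Finset.sum_insert hi, Finset.sum_insert hi, TT_add, ih]

theorem TT_mul {n : ℕ} (D : Derivation ℤ ℂ ℂ) (a : Fin n → ℂ) (q r) :
    TT D a (q * r) = eval a q * TT D a r + eval a r * TT D a q := by
  simp only [TT, map_mul, Derivation.leibniz, smul_eq_mul, map_add, add_mul,
    Finset.sum_add_distrib, mul_sub, Finset.mul_sum, mul_assoc]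
  ring

theorem TT_C {n : ℕ} (D : Derivation ℤ ℂ ℂ) (a : Fin n → ℂ) (c : ℂ) :
    TT D a (C c) = D c := by
  simp [TT]

theorem TT_X {n : ℕ} (D : Derivation ℤ ℂ ℂ) (a : Fin n → ℂ) (t) :
    TT D a (X t) = 0 := by
  simp [TT, pderiv_X, Pi.single_apply, apply_ite]

theorem TT_X_pow {n : ℕ} (D : Derivation ℤ ℂ ℂ) (a : Fin n → ℂ) (t) (e : ℕ) :
    TT D a (X t ^ e) = 0 := by
  induction e with
  | zero => simpa using TT_C D a 1
  | succ e ih => rw [pow_succ, TT_mul, ih, TT_X]; simp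

theorem TT_monomial {n : ℕ} (D : Derivation ℤ ℂ ℂ) (a : Fin n → ℂ) (m) (c : ℂ) (hc : D c = 0) :
    TT D a (monomial m c) = 0 := by
  induction m using Finsupp.induction_linear generalizing c with
  | zero => rw [← C_apply, TT_C, hc]
  | add m m' h h' =>
    have : (monomial (m + m') c : MvPolynomial (Fin n) ℂ) = monomial m c * monomial m' 1 := by
      simp [monomial_mul]
    rw [this, TT_mul, h c hc, h' 1 (by simp)]; simp
  | single t e =>
    rw [← C_mul_X_pow_eq_monomial, TT_mul, TT_X_pow, TT_C, hc]; simp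

theorem TT_eq_zero {n : ℕ} (D : Derivation ℤ ℂ ℂ) (a : Fin n → ℂ) (q : MvPolynomial (Fin n) ℂ)
    (h : ∀ m, D (coeff m q) = 0) : TT D a q = 0 := by
  rw [q.as_sum, TT_sum]
  exact Finset.sum_eq_zero fun m _ => TT_monomial D a m _ (h m)


theorem rank_eq_iff {m n : ℕ} (A : Matrix (Fin m) (Fin n) ℂ) :
    A.rank = m ↔ LinearIndependent ℂ A.row := by
  rw [A.rank_eq_finrank_span_row, linearIndependent_iff_card_eq_finrank_span, Set.finrank,
    Fintype.card_fin, eq_comm]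

theorem chain_core {n k : ℕ} (f g : Fin k → MvPolynomial (Fin n) ℂ)
    (h : Fin k → Fin k → MvPolynomial (Fin n) ℂ) (d : Fin k → ℕ)
    (p : Fin k × Fin k × Fin n → ℂ)
    (hp : ∀ l, ∃ D : Derivation ℤ ℂ ℂ, (∀ s m, D (coeff m (f s)) = 0) ∧
      ∀ l', D (p l') = if l' = l then 1 else 0)
    (hh : ∀ i j, h i j = ∑ t, C (p (i, j, t)) * X t ^ (d i - d j))
    (hg : ∀ i : Fin k, g i = f i + ∑ j ∈ Finset.univ.filter (fun j => i < j), h i j * f j)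
    (a : Fin n → ℂ) (ha : a ≠ 0)
    (hsmooth : (∀ s, eval a (f s) = 0) →
      LinearIndependent ℂ (fun (s : Fin k) (t : Fin n) => eval a (pderiv t (f s))))
    (i : Fin k) (hi : ∀ s ≤ i, eval a (g s) = 0)
    (c : Fin k → ℂ) (hci : ∀ s, i < s → c s = 0)
    (hc : ∀ t, ∑ s, c s * eval a (pderiv t (g s)) = 0) : c = 0 := by
  by_contra hne
  obtain ⟨i0, hi0⟩ := Function.ne_iff.mp hne
  have hi0 : c i0 ≠ 0 := hi0
  have hle : i0 ≤ i := by
    by_contra hlt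
    exact hi0 (hci i0 (not_le.mp hlt))
  -- points of higher equations
  have hf1 : ∀ j, i0 < j → eval a (f j) = 0 := by
    intro j hj
    obtain ⟨t0, ht0⟩ := Function.ne_iff.mp ha
    have ht0 : a t0 ≠ 0 := ht0
    obtain ⟨D, hD1, hD2⟩ := hp (i0, j, t0)
    have hTf : ∀ s, TT D a (f s) = 0 := fun s => TT_eq_zero D a _ (hD1 s)
    have hTh : ∀ s j', TT D a (h s j') =
        if s = i0 ∧ j' = j then a t0 ^ (d s - d j') else 0 := by
      intro s j'
      rw [hh, TT_sum]
      simp only [TT_mul, TT_X_pow, TT_C, hD2, Prod.mk.injEq, map_pow, eval_X, mul_zero, zero_add]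
      by_cases h1 : s = i0 ∧ j' = j
      · simp [h1.1, h1.2]
      · rw [if_neg h1]
        refine Finset.sum_eq_zero fun t _ => ?_
        rw [if_neg (fun hh => h1 ⟨hh.1, hh.2.1⟩), mul_zero]
    have hTg : ∀ s, TT D a (g s) =
        if s = i0 then eval a (f j) * a t0 ^ (d s - d j) else 0 := by
      intro s
      rw [hg, TT_add, hTf, TT_sum, zero_add]
      simp only [TT_mul, hTf, hTh, mul_zero, zero_add]
      by_cases h1 : s = i0
      · subst h1
        rw [if_pos rfl, Finset.sum_eq_single j]
        · simp
        · intro b _ hb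
          simp [hb]
        · intro hb
          simp [hj] at hb
      · simp [h1]
    have key : ∑ s, c s * TT D a (g s) = 0 := by
      have : ∀ s, c s * TT D a (g s) =
          - ∑ t, c s * eval a (pderiv t (g s)) * D (a t) := by
        intro s
        by_cases hs : s ≤ i
        · rw [TT, hi s hs]
          simp [Finset.mul_sum, mul_assoc]
        · simp [hci s (not_le.mp hs)]
      simp only [this, Finset.sum_neg_distrib]
      rw [Finset.sum_comm]
      simp only [← Finset.sum_mul, hc]
      simp
    simp only [hTg, mul_ite, mul_zero, Finset.sum_ite_eq', Finset.mem_univ, if_true] at key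
    have := pow_ne_zero (d i0 - d j) ht0
    simpa [hi0, this] using key
  have hf : ∀ s, eval a (f s) = 0 := by
    intro s
    induction s using WellFoundedGT.induction with
    | ind s ih =>
      by_cases hs : i0 < s
      · exact hf1 s hs
      · have h1 := hi s ((not_lt.mp hs).trans hle)
        rw [hg, map_add, map_sum, Finset.sum_eq_zero, add_zero] at h1
        · exact h1
        · intro j hj
          rw [map_mul, ih j (by simpa using hj), mul_zero]
  have hli := hsmooth hf
  rw [Fintype.linearIndependent_iff] at hli
  have hpg : ∀ s t, eval a (pderiv t (g s)) = eval a (pderiv t (f s)) +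
      ∑ j, (if s < j then eval a (h s j) else 0) * eval a (pderiv t (f j)) := by
    intro s t
    rw [hg, map_add, map_add, map_sum, map_sum, Finset.sum_filter]
    congr 1
    refine Finset.sum_congr rfl fun j _ => ?_
    split_ifs
    · simp [hf j]
    · simp
  have hco := hli (fun j => c j + ∑ s, c s * (if s < j then eval a (h s j) else 0)) (by
    ext t
    have := hc t
    simp only [hpg, mul_add, Finset.sum_add_distrib, Finset.mul_sum] at this
    rw [Finset.sum_comm] at this
    simp only [Finset.sum_apply, Pi.smul_apply, smul_eq_mul, Pi.zero_apply, add_mul,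
      Finset.sum_mul, Finset.sum_add_distrib, mul_assoc]
    exact this)
  have hz : ∀ s, c s = 0 := by
    intro s
    induction s using WellFoundedLT.induction with
    | ind s ih =>
      have h1 := hco s
      rw [Finset.sum_eq_zero, add_zero] at h1
      · exact h1
      · intro j _
        split_ifs with hjs
        · rw [ih j hjs, zero_mul]
        · simp
  exact hi0 (hz i0)

/-- Lemma 2.1 of the paper.  Let `f₁,…,f_k ∈ ℂ[x₀,…,x_N]` be homogeneous
of degrees `d₁ ≥ d₂ ≥ ⋯ ≥ d_k`, cutting out a smooth complete intersection of codimension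
`k` in `ℙ^N` (Jacobian criterion: the `k × (N+1)` Jacobian has rank `k` at every nonzero
point of the affine cone).  Then there are homogeneous `h_{ij}` of degree `dᵢ − d_j`
(`i < j`) such that, with `gᵢ = fᵢ + Σ_{j>i} h_{ij} f_j`:
(a) the ideals `(g₁,…,g_k)` and `(f₁,…,f_k)` coincide, and
(b) each `V(g₁,…,gᵢ)` is a smooth complete intersection of codimension `i`
(the `i × (N+1)` Jacobian of `g₁,…,gᵢ` has rank `i` at every nonzero point of its cone). -/
theorem smooth_complete_intersection_chain (N k : ℕ)
    (f : Fin k → MvPolynomial (Fin (N + 1)) ℂ) (d : Fin k → ℕ)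
    (hdmono : ∀ i j : Fin k, i ≤ j → d j ≤ d i)
    (hhom : ∀ i, (f i).IsHomogeneous (d i))
    (hsmooth : ∀ a : Fin (N + 1) → ℂ, a ≠ 0 → (∀ s, eval a (f s) = 0) →
      (Matrix.of fun (s : Fin k) (t : Fin (N + 1)) => eval a (pderiv t (f s))).rank = k) :
    ∃ h : Fin k → Fin k → MvPolynomial (Fin (N + 1)) ℂ,
      (∀ i j : Fin k, i < j → (h i j).IsHomogeneous (d i - d j)) ∧
      ∃ g : Fin k → MvPolynomial (Fin (N + 1)) ℂ,
        (∀ i : Fin k, g i = f i + ∑ j ∈ Finset.univ.filter (fun j => i < j), h i j * f j) ∧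
        Ideal.span (Set.range g) = Ideal.span (Set.range f) ∧
        (∀ i : Fin k, ∀ a : Fin (N + 1) → ℂ, a ≠ 0 →
          (∀ s : Fin (i + 1), eval a (g (Fin.castLE i.isLt s)) = 0) →
          (Matrix.of fun (s : Fin (i + 1)) (t : Fin (N + 1)) =>
            eval a (pderiv t (g (Fin.castLE i.isLt s)))).rank = i + 1) := by
  classical
  obtain ⟨p, hp⟩ := exists_deriv (⋃ s, (fun m => coeff m (f s)) '' ((f s).support : Set _))
    (Set.finite_iUnion fun s => (Finset.finite_toSet _).image _) (Fin k × Fin k × Fin (N + 1))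
  have hp' : ∀ l, ∃ D : Derivation ℤ ℂ ℂ, (∀ s m, D (coeff m (f s)) = 0) ∧
      ∀ l', D (p l') = if l' = l then 1 else 0 := by
    intro l
    obtain ⟨D, h1, h2⟩ := hp l
    refine ⟨D, fun s m => ?_, h2⟩
    by_cases hm : m ∈ (f s).support
    · exact h1 _ (Set.mem_iUnion.mpr ⟨s, m, hm, rfl⟩)
    · rw [notMem_support_iff.mp hm, map_zero]
  let h : Fin k → Fin k → MvPolynomial (Fin (N + 1)) ℂ :=
    fun i j => ∑ t, C (p (i, j, t)) * X t ^ (d i - d j)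
  let g : Fin k → MvPolynomial (Fin (N + 1)) ℂ :=
    fun i => f i + ∑ j ∈ Finset.univ.filter (fun j => i < j), h i j * f j
  refine ⟨h, ?_, g, fun i => rfl, ?_, ?_⟩
  · intro i j _
    refine IsHomogeneous.sum _ _ _ fun t _ => ?_
    simpa using (isHomogeneous_C _ (p (i, j, t))).mul ((isHomogeneous_X ℂ t).pow (d i - d j))
  · apply le_antisymm
    · rw [Ideal.span_le]
      rintro _ ⟨i, rfl⟩
      refine Ideal.add_mem _ (Ideal.subset_span ⟨i, rfl⟩) (Ideal.sum_mem _ fun j _ => ?_)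
      exact Ideal.mul_mem_left _ _ (Ideal.subset_span ⟨j, rfl⟩)
    · rw [Ideal.span_le]
      rintro _ ⟨i, rfl⟩
      change f i ∈ Ideal.span (Set.range g)
      induction i using WellFoundedGT.induction with
      | ind i ih =>
        have : f i = g i - ∑ j ∈ Finset.univ.filter (fun j => i < j), h i j * f j := by
          simp [g]
        rw [this]
        refine Ideal.sub_mem _ (Ideal.subset_span ⟨i, rfl⟩) (Ideal.sum_mem _ fun j hj => ?_)
        exact Ideal.mul_mem_left _ _ (ih j (by simpa using hj))
  · intro i a ha hga
    rw [rank_eq_iff, Fintype.linearIndependent_iff]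
    intro c hc
    have hinj : Function.Injective (Fin.castLE i.isLt : Fin (i + 1) → Fin k) :=
      Fin.castLE_injective _
    have hrange : ∀ s : Fin k, s ≤ i → ∃ s' : Fin (i + 1), Fin.castLE i.isLt s' = s :=
      fun s hs => ⟨⟨s, Nat.lt_succ_of_le hs⟩, rfl⟩
    have hcore := chain_core f g h d p hp' (fun _ _ => rfl) (fun _ => rfl) a ha
      (fun hf => (rank_eq_iff _).mp (hsmooth a ha hf)) i
      (by
        intro s hs
        obtain ⟨s', rfl⟩ := hrange s hs
        exact hga s')
      (Function.extend (Fin.castLE i.isLt) c 0)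
      (by
        intro s hs
        rw [Function.extend_apply', Pi.zero_apply]
        rintro ⟨s', rfl⟩
        exact absurd (Fin.lt_def.mp hs) (by have := s'.isLt; simp; omega))
      (by
        intro t
        have hct := congrFun hc t
        rw [Finset.sum_apply] at hct
        refine Eq.trans (Eq.symm ?_) hct
        apply Fintype.sum_of_injective _ hinj
        · intro s hs
          rw [Function.extend_apply', Pi.zero_apply, zero_mul]
          exact hs
        · intro s
          rw [hinj.extend_apply]
          rfl)
    intro s
    have := congrFun hcore (Fin.castLE i.isLt s)
    rwa [hinj.extend_apply] at this
end

section
/- Let n ≥ 3 and 2 ≤ q ≤ n − 1. Let ω be a nonzero polynomial q-form on ℂ^{n+1} whose coefficients are homogeneous of degree 1, and assume: (i) ι_𝓡 ω = 0, where 𝓡 = Σᵢ xᵢ ∂/∂xᵢ is the radial vector field; (ii) the ideal of ℂ[x₀,…,x_n] generated by the coefficients of ω has height at least 2 (the singular set of ω has codimension at least 2); (iii) for all constant vectors u₁,…,u_{q−1} ∈ ℂ^{n+1} one has (ι_{u₁}⋯ι_{u_{q−1}} ω) ∧ ω = 0 (local decomposability off the singular set). Then ω is integrable: (ι_{u₁}⋯ι_{u_{q−1}}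 ω) ∧ dω = 0 for all constant vectors u₁,…,u_{q−1} ∈ ℂ^{n+1}. (Equivalently: every degree-zero distribution of codimension q ≥ 2 on ℙⁿ is integrable.) -/
open MvPolynomial

noncomputable section DegZeroDistributions

/-- A polynomial `q`-form on `ℂ^M` is recorded by its alternating coefficient function
`w : (Fin q → Fin M) → ℂ[x]`, so that `ω = Σ_{i₁<⋯<i_q} w(i₁,…,i_q) dx_{i₁}∧⋯∧dx_{i_q}`.
`FormIsAlt` says the coefficient function is alternating. -/
def FormIsAlt {M q : ℕ} (w : (Fin q → Fin M) → MvPolynomial (Fin M) ℂ) : Prop :=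
  ∀ (σ : Fin q → Fin M) (π : Equiv.Perm (Fin q)),
    w (σ ∘ π) = (Equiv.Perm.sign π : ℤ) • w σ

/-- Multilinear evaluation of the `q`-form with coefficients `w` on a tuple of vector
fields: `ω(v₁,…,v_q) = Σ_σ (∏_t v_t(σ t)) · w(σ)`. -/
def formEval {M q : ℕ} (w : (Fin q → Fin M) → MvPolynomial (Fin M) ℂ)
    (v : Fin q → (Fin M → MvPolynomial (Fin M) ℂ)) : MvPolynomial (Fin M) ℂ :=
  ∑ σ : Fin q → Fin M, (∏ t, v t (σ t)) * w σ

/-- The `1`-form `ι_{u₁}⋯ι_{u_{q-1}} ω` obtained by contracting a `q`-form (coefficients `w`)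
with `q−1` constant vector fields `u`; its `j`-th coefficient is
`ω(u₁,…,u_{q−1}, e_j)`. -/
def contrConsts {M q : ℕ} (w : (Fin (q + 1) → Fin M) → MvPolynomial (Fin M) ℂ)
    (u : Fin q → (Fin M → ℂ)) (j : Fin M) : MvPolynomial (Fin M) ℂ :=
  formEval w (Fin.snoc (fun t i => C (u t i)) (Pi.single j 1))

/-- Coefficient function of the exterior derivative `dω` of the `q`-form with
coefficients `w`:  `(dω)_{ρ₀…ρ_q} = Σ_s (−1)^s ∂_{ρ_s} w(ρ₀,…,ρ̂_s,…,ρ_q)`. -/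
def dCoeff {M q : ℕ} (w : (Fin q → Fin M) → MvPolynomial (Fin M) ℂ)
    (ρ : Fin (q + 1) → Fin M) : MvPolynomial (Fin M) ℂ :=
  ∑ s : Fin (q + 1), (-1 : MvPolynomial (Fin M) ℂ) ^ (s : ℕ)
    * pderiv (ρ s) (w (fun t => ρ (s.succAbove t)))

/-- Height of an ideal: the infimum of the heights of the prime ideals containing it
(heights taken in the poset of prime ideals). -/
def idealHeight {R : Type*} [CommRing R] (I : Ideal R) : ℕ∞ :=
  ⨅ (P : {P : Ideal R // P.IsPrime}) (_ : I ≤ P.1), Order.height P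

open Module

theorem exists_perm_two {N : ℕ} (a b i j : Fin N) (hab : a ≠ b) (hij : i ≠ j) :
    ∃ π : Equiv.Perm (Fin N), π a = i ∧ π b = j := by
  refine ⟨Equiv.swap a i * Equiv.swap b (Equiv.swap a i j), ?_, ?_⟩
  · have h : a ≠ Equiv.swap a i j := by
      intro h
      have := congrArg (Equiv.swap a i) h
      simp at this
      exact hij this
    rw [Equiv.Perm.mul_apply, Equiv.swap_apply_of_ne_of_ne hab h, Equiv.swap_apply_left]
  · simp

section core
variable {V : Type*} [AddCommGroup V] [Module ℂ V]

theorem map_perm_zero {N : ℕ} (Ω : V [⋀^Fin N]→ₗ[ℂ] ℂ) (y : Fin N → V)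
    (π : Equiv.Perm (Fin N)) : Ω (y ∘ π) = 0 ↔ Ω y = 0 := by
  rw [AlternatingMap.map_perm]
  rcases Int.units_eq_one_or (Equiv.Perm.sign π) with h | h <;> simp [h]

def Pl (m : ℕ) (Ω : V [⋀^Fin (m+3)]→ₗ[ℂ] ℂ) : Prop :=
  ∀ x (u : Fin (m+1) → V) (b : Fin (m+3) → V),
    ∑ s : Fin (m+3), (-1 : ℂ)^(s:ℕ) * Ω (Fin.cons x (Fin.snoc u (b s))) *
      Ω (Fin.cons x (fun t => b (s.succAbove t))) = 0

theorem upd_last {V : Type*} {m : ℕ} (v : Fin (m+3) → V) (y : V) :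
    (Fin.cons (v 0) (Fin.snoc (fun t : Fin (m+1) => v t.castSucc.succ) y) : Fin (m+3) → V)
      = Function.update v (Fin.last _) y := by
  funext t
  refine Fin.cases ?_ (fun t => ?_) t
  · rw [Fin.cons_zero, Function.update_of_ne]
    exact (Fin.last_pos).ne
  · rw [Fin.cons_succ]
    refine Fin.lastCases ?_ (fun t => ?_) t
    · rw [Fin.snoc_last, Fin.succ_last, Function.update_self]
    · rw [Fin.snoc_castSucc, Function.update_of_ne]
      rw [Fin.succ_castSucc]
      exact (Fin.castSucc_lt_last _).ne

theorem caseA0 {m : ℕ} {Ω : V [⋀^Fin (m+3)]→ₗ[ℂ] ℂ} (H : Pl m Ω) (v : Fin (m+3) → V)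
    (hv : Ω v ≠ 0) (r : Fin (m+2) → V)
    (hr : ∀ j, Ω (Function.update v (Fin.last _) (r j)) = 0) :
    Ω (Fin.cons (v 0) r) = 0 := by
  have h := H (v 0) (fun t : Fin (m+1) => v t.castSucc.succ) (Fin.cons (v (Fin.last _)) r)
  simp only [upd_last] at h
  rw [Fin.sum_univ_succ, Finset.sum_eq_zero] at h
  · simpa [hv] using h
  · intro s _
    simp [hr]

theorem caseB0 {m : ℕ} {Ω : V [⋀^Fin (m+3)]→ₗ[ℂ] ℂ} (H : Pl m Ω) (v : Fin (m+3) → V)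
    (hv : Ω v ≠ 0) (k : V) (r : Fin (m+2) → V)
    (hk : Ω (Function.update v 0 k) = 0)
    (hr : ∀ j, Ω (Function.update v (Fin.last _) (r j)) = 0)
    (hA1 : Ω (Fin.cons (v 0) r) = 0)
    (hA2 : ∀ j, Ω (Fin.cons k (Fin.snoc (fun t : Fin (m+1) => v t.castSucc.succ) (r j))) = 0) :
    Ω (Fin.cons k r) = 0 := by
  have h := H (v 0 + k) (fun t : Fin (m+1) => v t.castSucc.succ) (Fin.cons (v (Fin.last _)) r)
  have hadd : ∀ z : Fin (m+2) → V, Ω (Fin.cons (v 0 + k) z) =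
      Ω (Fin.cons (v 0) z) + Ω (Fin.cons k z) := fun z => by
    exact Ω.toMultilinearMap.cons_add z (v 0) k
  simp only [hadd, upd_last] at h
  rw [Fin.sum_univ_succ, Finset.sum_eq_zero] at h
  · have h2 : (Fin.cons k (Fin.snoc (fun t : Fin (m+1) => v t.castSucc.succ) (v (Fin.last _))) :
        Fin (m+3) → V) = Function.update v 0 k := by
      funext t
      refine Fin.cases ?_ (fun t => ?_) t
      · simp
      · rw [Fin.cons_succ, Function.update_of_ne (Fin.succ_ne_zero _)]
        refine Fin.lastCases ?_ (fun t => ?_) t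
        · simp
        · simp
    simpa [hv, h2, hk, hA1] using h
  · intro s _
    simp [hr, hA2]

/-- adapted decomposition -/
theorem exists_adapted [FiniteDimensional ℂ V] {N : ℕ} (v : Fin N → V) (α : Fin N → V →ₗ[ℂ] ℂ)
    (h : ∀ i j, α i (v j) = if i = j then 1 else 0) :
    ∃ (d : ℕ) (e : Basis (Fin N ⊕ Fin d) ℂ V), (∀ i, e (Sum.inl i) = v i) ∧
      ∀ i k, α i (e (Sum.inr k)) = 0 := by
  let A : V →ₗ[ℂ] (Fin N → ℂ) := LinearMap.pi α
  let S : (Fin N → ℂ) →ₗ[ℂ] V := Fintype.linearCombination ℂ v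
  have hAS : ∀ a, A (S a) = a := by
    intro a
    funext i
    simp [A, S, Fintype.linearCombination_apply, h]
  let E : ((Fin N → ℂ) × LinearMap.ker A) ≃ₗ[ℂ] V :=
    LinearEquiv.ofBijective (S.coprod (LinearMap.ker A).subtype) (by
      constructor
      · rw [← LinearMap.ker_eq_bot, LinearMap.ker_eq_bot']
        rintro ⟨a, k, hk⟩ h0
        simp at h0
        have h1 := congrArg A h0
        rw [map_add, hAS, LinearMap.mem_ker.1 hk] at h1
        simp at h1
        subst h1
        simpa using h0
      · intro y
        refine ⟨(A y, ⟨y - S (A y), ?_⟩), ?_⟩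
        · simp [hAS]
        · simp)
  refine ⟨_, ((Pi.basisFun ℂ (Fin N)).prod (Module.finBasis ℂ (LinearMap.ker A))).map E, ?_, ?_⟩
  · intro i
    rw [Basis.map_apply]
    change S _ + ((_ : LinearMap.ker A) : V) = _
    simp [S, Fintype.linearCombination_apply_single]
  · intro i k
    have : ∀ z : LinearMap.ker A, α i z = 0 := fun z => congrFun (LinearMap.mem_ker.1 z.2) i
    rw [Basis.map_apply]
    change α i (S _ + ((_ : LinearMap.ker A) : V)) = _
    rw [map_add, this]
    simp

theorem core [FiniteDimensional ℂ V] {m : ℕ} {Ω : V [⋀^Fin (m+3)]→ₗ[ℂ] ℂ} (H : Pl m Ω)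
    (x : V) (u : Fin (m+1) → V) (b : Fin (m+4) → V) :
    ∑ s : Fin (m+4), (-1 : ℂ)^(s:ℕ) * Ω (Fin.cons x (Fin.snoc u (b s))) *
      Ω (fun t => b (s.succAbove t)) = 0 := by
  by_cases hΩ : Ω = 0
  · simp [hΩ]
  obtain ⟨v, hv⟩ : ∃ v, Ω v ≠ 0 := by
    by_contra! h
    exact hΩ (by ext v; simpa using h v)
  obtain ⟨d, e, he, hα⟩ := exists_adapted v
    (fun i => (Ω v)⁻¹ • Ω.toMultilinearMap.toLinearMap v i) (by
      intro i j
      split_ifs with hij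
      · subst hij
        simp [hv]
      · simp only [LinearMap.smul_apply, MultilinearMap.toLinearMap_apply, smul_eq_mul,
          mul_eq_zero]
        right
        refine Ω.map_eq_zero_of_eq (i := i) (j := j) _ ?_ hij
        rw [Function.update_self, Function.update_of_ne (Ne.symm hij)])
  have hK : ∀ i k, Ω (Function.update v i (e (Sum.inr k))) = 0 := by
    intro i k
    simpa [hv] using hα i k
  have hU : ∀ i c, c ≠ Sum.inl i → Ω (Function.update v i (e c)) = 0 := by
    rintro i (j | k) hc
    · refine Ω.map_eq_zero_of_eq (i := i) (j := j) _ ?_ ?_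
      · rw [Function.update_self, Function.update_of_ne, he]
        rintro rfl; exact hc rfl
      · rintro rfl; exact hc rfl
    · exact hK i k
  -- case A
  have hA : ∀ (i : Fin (m+3)) (k : Fin d) (c : Fin (m+1) → Fin (m+3) ⊕ Fin d),
      Ω (Fin.cons (v i) (Fin.cons (e (Sum.inr k)) (fun t => e (c t)))) = 0 := by
    intro i k c
    obtain ⟨i', hi'⟩ : ∃ i', i' ≠ i ∧ ∀ t, c t ≠ Sum.inl i' := by
      by_contra! hcon
      have hs : Function.Surjective
          (Fin.cons i (fun t => Sum.elim id (fun _ => i) (c t)) : Fin (m+2) → Fin (m+3)) := by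
        intro j
        by_cases hj : j = i
        · exact ⟨0, by simp [hj]⟩
        · obtain ⟨t, ht⟩ := hcon j hj
          exact ⟨t.succ, by simp [ht]⟩
      simpa using Fintype.card_le_of_surjective _ hs
    obtain ⟨π, h0, hl⟩ := exists_perm_two (0 : Fin (m+3)) (Fin.last _) i i'
      (Fin.last_pos).ne (Ne.symm hi'.1)
    have := caseA0 H (v ∘ π) (by rwa [Ne, map_perm_zero])
      (Fin.cons (e (Sum.inr k)) (fun t => e (c t))) (by
        intro j
        have hup : ∀ y, Function.update (v ∘ π) (Fin.last _) y = Function.update v i' y ∘ π := by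
          intro y
          rw [← hl, Function.update_comp_eq_of_injective _ π.injective]
        rw [hup, map_perm_zero]
        refine Fin.cases ?_ (fun t => ?_) j
        · simpa using hK _ _
        · simpa using hU _ _ (hi'.2 t))
    simpa [h0] using this
  have hA' : ∀ (c : Fin (m+3) → Fin (m+3) ⊕ Fin d) (i j) (a k), c i = Sum.inl a →
      c j = Sum.inr k → Ω (fun t => e (c t)) = 0 := by
    intro c i j a k hi hj
    obtain ⟨π, h0, h1⟩ := exists_perm_two (0 : Fin (m+3)) 1 i j (by simp)
      (by rintro rfl; rw [hi] at hj; cases hj)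
    rw [← map_perm_zero Ω _ π]
    convert hA a k (fun t => c (π t.succ.succ)) using 2
    funext t
    refine Fin.cases ?_ (fun t => ?_) t
    · simp [h0, hi, he]
    · refine Fin.cases ?_ (fun t => ?_) t
      · simp [h1, hj]
      · simp
  have hC : ∀ (c : Fin (m+3) → Fin (m+3) ⊕ Fin d) (j k),
      c j = Sum.inr k → Ω (fun t => e (c t)) = 0 := by
    intro c j k hj
    by_cases hi : ∃ i a, c i = Sum.inl a
    · obtain ⟨i, a, hi⟩ := hi
      exact hA' c i j a k hi hj
    have hall : ∀ i, ∃ a, c i = Sum.inr a := by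
      intro i
      rcases hci : c i with a | a
      · exact absurd ⟨i, a, hci⟩ hi
      · exact ⟨a, rfl⟩
    choose f hf using hall
    have := caseB0 H v hv (e (c 0)) (fun t => e (c t.succ)) (by rw [hf]; exact hK _ _)
      (by intro j; simp only [hf]; exact hK _ _)
      (by
        convert hA' (Fin.cons (Sum.inl 0) (fun t => c t.succ)) 0 1 0 (f 1) (by simp)
          (by rw [← Fin.succ_zero_eq_one, Fin.cons_succ, hf]) using 2
        funext t
        refine Fin.cases ?_ (fun t => ?_) t <;> simp [he])
      (by
        intro j
        convert hA' (Fin.cons (c 0) (Fin.snoc (fun t : Fin (m+1) => Sum.inl t.castSucc.succ)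
          (c j.succ))) (Fin.succ (Fin.castSucc 0)) 0 _ (f 0)
          (by rw [Fin.cons_succ, Fin.snoc_castSucc]) (by simp [hf]) using 2
        funext t
        refine Fin.cases ?_ (fun t => ?_) t
        · simp
        · refine Fin.lastCases ?_ (fun t => ?_) t <;> simp [he])
    convert this using 2
    funext t
    refine Fin.cases ?_ (fun t => ?_) t <;> simp
  have hcur : ∀ k, Ω.curryLeft (e (Sum.inr k)) = 0 := by
    intro k
    refine Basis.ext_alternating e ?_
    intro c _
    simp only [AlternatingMap.curryLeft_apply_apply, AlternatingMap.zero_apply]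
    convert hC (Fin.cons (Sum.inr k) c) 0 k (by simp) using 2
    funext t
    refine Fin.cases ?_ (fun t => ?_) t <;> simp
  have hD : ∀ (y : Fin (m+3) → V) j k, y j = e (Sum.inr k) → Ω y = 0 := by
    intro y j k hj
    rw [← map_perm_zero Ω y (Equiv.swap 0 j)]
    have := DFunLike.congr_fun (hcur k) (fun t => y (Equiv.swap 0 j t.succ))
    rw [AlternatingMap.curryLeft_apply_apply, AlternatingMap.zero_apply] at this
    convert this using 2
    funext t
    refine Fin.cases ?_ (fun t => ?_) t <;> simp [hj]
  -- final
  let α : V →ₗ[ℂ] ℂ := Ω.toMultilinearMap.toLinearMap (Fin.cons x (Fin.snoc u 0)) (Fin.last _)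
  have hαy : ∀ y, α y = Ω (Fin.cons x (Fin.snoc u y)) := by
    intro y
    simp only [α, MultilinearMap.toLinearMap_apply]
    change Ω _ = _
    congr 1
    rw [← Fin.succ_last, ← Fin.cons_update, Fin.update_snoc_last]
  have hzero : AlternatingMap.alternatizeUncurryFin (α.smulRight Ω) = 0 := by
    refine Basis.ext_alternating e ?_
    intro c hc
    rw [AlternatingMap.alternatizeUncurryFin_apply, AlternatingMap.zero_apply]
    obtain ⟨s0, k, hs0⟩ : ∃ s0 k, c s0 = Sum.inr k := by
      by_contra! hcon
      have hall : ∀ s, ∃ a, c s = Sum.inl a := by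
        intro s
        rcases hci : c s with a | a
        · exact ⟨a, rfl⟩
        · exact absurd hci (hcon s a)
      choose f hf using hall
      have hfi : Function.Injective f := fun a b hab => hc (by rw [hf, hf, hab])
      simpa using Fintype.card_le_of_injective f hfi
    refine Finset.sum_eq_zero fun s _ => ?_
    by_cases hs : s = s0
    · subst hs
      have : α (e (c s)) = 0 := by
        rw [hαy]
        exact hD _ (Fin.last _) k (by rw [← Fin.succ_last, Fin.cons_succ, Fin.snoc_last, hs0])
      simp [this]
    · obtain ⟨t, ht⟩ := Fin.exists_succAbove_eq (Ne.symm hs)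
      have : Ω (s.removeNth fun i => e (c i)) = 0 := hD _ t k (by simp [Fin.removeNth, ht, hs0])
      simp [this]
  have := DFunLike.congr_fun hzero b
  rw [AlternatingMap.alternatizeUncurryFin_apply, AlternatingMap.zero_apply] at this
  rw [← this]
  refine Finset.sum_congr rfl fun s _ => ?_
  simp only [LinearMap.smulRight_apply, AlternatingMap.smul_apply, hαy, smul_eq_mul,
    zsmul_eq_mul, mul_assoc]
  push_cast
  rfl

end core

section transl

theorem lin_form {M : ℕ} {p : MvPolynomial (Fin M) ℂ} (hp : p.IsHomogeneous 1) :
    p = ∑ i, C (p.coeff (Finsupp.single i 1)) * X i := by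
  have h : p ∈ Submodule.span ℂ (Set.range (X : Fin M → MvPolynomial (Fin M) ℂ)) := by
    rw [← homogeneousSubmodule_one_eq_span_X]
    exact (mem_homogeneousSubmodule 1 p).2 hp
  induction h using Submodule.span_induction with
  | mem x hx =>
    obtain ⟨j, rfl⟩ := hx
    rw [Finset.sum_eq_single j]
    · simp
    · intro i _ hij
      have : coeff (Finsupp.single i 1) (X j : MvPolynomial (Fin M) ℂ) = 0 := by
        rw [coeff_X, if_neg]
        intro h
        exact hij (Finsupp.single_left_injective one_ne_zero h).symm
      simp [this]
    · simp
  | zero => simp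
  | add x y _ _ hx hy =>
    have hxh : x.IsHomogeneous 1 := by
      rw [← mem_homogeneousSubmodule, homogeneousSubmodule_one_eq_span_X]; assumption
    have hyh : y.IsHomogeneous 1 := by
      rw [← mem_homogeneousSubmodule, homogeneousSubmodule_one_eq_span_X]; assumption
    conv_lhs => rw [hx hxh, hy hyh]
    simp [add_mul, Finset.sum_add_distrib]
  | smul a x _ hx =>
    have hxh : x.IsHomogeneous 1 := by
      rw [← mem_homogeneousSubmodule, homogeneousSubmodule_one_eq_span_X]; assumption
    conv_lhs => rw [hx hxh]
    simp [Finset.smul_sum, smul_eq_C_mul, mul_assoc]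

theorem lin_eval {M : ℕ} {p : MvPolynomial (Fin M) ℂ} (hp : p.IsHomogeneous 1) (x : Fin M → ℂ) :
    eval x p = ∑ i, x i * p.coeff (Finsupp.single i 1) := by
  conv_lhs => rw [lin_form hp]
  simp [mul_comm]

theorem lin_pderiv {M : ℕ} {p : MvPolynomial (Fin M) ℂ} (hp : p.IsHomogeneous 1) (i : Fin M) :
    pderiv i p = C (p.coeff (Finsupp.single i 1)) := by
  conv_lhs => rw [lin_form hp]
  simp [pderiv_X, Pi.single_apply]

theorem quad_antisymm {M : ℕ} (g : Fin M → Fin M → ℂ)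
    (h : ∀ x : Fin M → ℂ, ∑ i, x i * ∑ j, x j * g i j = 0) (a b : Fin M) :
    g a b = - g b a := by
  have h1 : ∀ a, g a a = 0 := by
    intro a
    simpa [Pi.single_apply] using h (Pi.single a 1)
  have h2 := h (Pi.single a 1 + Pi.single b 1)
  simp [Pi.single_apply, add_mul, Finset.sum_add_distrib, h1] at h2
  linear_combination h2

/-- The constant-coefficient function of `dω` up to a scalar. -/
def gFun {M q : ℕ} (w : (Fin (q+1) → Fin M) → MvPolynomial (Fin M) ℂ)
    (ρ : Fin (q+2) → Fin M) : ℂ :=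
  (w (fun t => ρ t.succ)).coeff (Finsupp.single (ρ 0) 1)

theorem gFun_perm {M q : ℕ} (w : (Fin (q+1) → Fin M) → MvPolynomial (Fin M) ℂ)
    (halt : FormIsAlt w)
    (hlin : ∀ σ, (w σ).IsHomogeneous 1)
    (hrad : ∀ τ : Fin (q+1) → Fin M, ∑ i, X i * w (Function.update τ 0 i) = 0)
    (π : Equiv.Perm (Fin (q+2))) :
    ∀ ρ : Fin (q+2) → Fin M, gFun w (ρ ∘ π) = ((Equiv.Perm.sign π : ℤ) : ℂ) * gFun w ρ := by
  have hmem : π ∈ Submonoid.closure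
      (Set.range fun i : Fin (q+1) ↦ Equiv.swap i.castSucc i.succ) := by
    rw [Equiv.Perm.mclosure_swap_castSucc_succ]; trivial
  induction hmem using Submonoid.closure_induction with
  | one => intro ρ; simp
  | mul a b _ _ ha hb =>
    intro ρ
    have : ρ ∘ (a * b : Equiv.Perm _) = (ρ ∘ a) ∘ b := rfl
    rw [this, hb, ha]
    simp
    ring
  | mem π hπ =>
    obtain ⟨i, rfl⟩ := hπ
    intro ρ
    simp only [Equiv.Perm.sign_swap (Fin.castSucc_lt_succ (i := i)).ne]
    refine Fin.cases ?_ (fun i => ?_) i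
    · have key := quad_antisymm (fun i j =>
        (w (Function.update (fun t => ρ t.succ) 0 i)).coeff (Finsupp.single j 1)) (by
          intro x
          have := congrArg (eval x) (hrad (fun t => ρ t.succ))
          simpa [lin_eval (hlin _)] using this) (ρ 0) (ρ 1)
      have e1 : Function.update (fun t : Fin (q+1) => ρ t.succ) 0 (ρ 1) = fun t => ρ t.succ := by
        rw [← Fin.succ_zero_eq_one]
        exact Function.update_eq_self 0 _
      have e2 : Function.update (fun t : Fin (q+1) => ρ t.succ) 0 (ρ 0) =
          fun t => (ρ ∘ Equiv.swap (Fin.castSucc 0) (Fin.succ 0)) t.succ := by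
        funext t
        refine Fin.cases ?_ (fun t => ?_) t
        · simp
        · rw [Function.update_of_ne (Fin.succ_ne_zero _), Function.comp_apply,
            Equiv.swap_apply_of_ne_of_ne]
          · simp
          · simp [Fin.ext_iff]
      rw [e1, e2] at key
      simpa [gFun] using key
    · have e1 : (fun t : Fin (q+1) => (ρ ∘ Equiv.swap i.succ.castSucc i.succ.succ) t.succ) =
          (fun t => ρ t.succ) ∘ Equiv.swap i.castSucc i.succ := by
        funext t
        simp only [Function.comp_apply]
        congr 1
        rw [← Fin.succ_castSucc]
        exact ((Fin.succ_injective _).map_swap i.castSucc i.succ t).symm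
      have e2 : (ρ ∘ Equiv.swap i.succ.castSucc i.succ.succ) 0 = ρ 0 := by
        rw [Function.comp_apply, Equiv.swap_apply_of_ne_of_ne]
        · simp [Fin.ext_iff]
        · simp [Fin.ext_iff]
      rw [gFun, e1, e2, halt, Equiv.Perm.sign_swap (Fin.castSucc_lt_succ (i := i)).ne]
      simp [gFun]

/-- The alternating map attached to an alternating coefficient function. -/
def altOf {M N : ℕ} (G : (Fin N → Fin M) → ℂ)
    (hG : ∀ (π : Equiv.Perm (Fin N)) ρ, G (ρ ∘ π) = ((Equiv.Perm.sign π : ℤ) : ℂ) * G ρ) :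
    (Fin M → ℂ) [⋀^Fin N]→ₗ[ℂ] ℂ :=
  { (∑ ρ : Fin N → Fin M, G ρ • (MultilinearMap.mkPiAlgebra ℂ (Fin N) ℂ).compLinearMap
      (fun t => (LinearMap.proj (ρ t) : (Fin M → ℂ) →ₗ[ℂ] ℂ)) :
        MultilinearMap ℂ (fun _ : Fin N => Fin M → ℂ) ℂ) with
    map_eq_zero_of_eq' := by
      intro v i j hv hij
      simp
      have hvs : ∀ t, v (Equiv.swap i j t) = v t := by
        intro t
        rcases eq_or_ne t i with rfl | hi
        · simp [hv]
        · rcases eq_or_ne t j with rfl | hj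
          · simp [hv]
          · rw [Equiv.swap_apply_of_ne_of_ne hi hj]
      have h : ∑ ρ : Fin N → Fin M, G ρ * ∏ t, v t (ρ t) =
          - ∑ ρ : Fin N → Fin M, G ρ * ∏ t, v t (ρ t) := by
        rw [← Finset.sum_neg_distrib]
        refine Fintype.sum_equiv (Equiv.arrowCongr (Equiv.swap i j) (Equiv.refl _)) _ _ ?_
        intro ρ
        have e : (Equiv.arrowCongr (Equiv.swap i j) (Equiv.refl (Fin M))) ρ
            = ρ ∘ Equiv.swap i j := by
          funext t; simp
        rw [e, hG, Equiv.Perm.sign_swap hij]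
        have : ∏ t, v t ((ρ ∘ Equiv.swap i j) t) = ∏ t, v t (ρ t) := by
          rw [← Equiv.prod_comp (Equiv.swap i j)]
          simp [hvs]
        rw [this]
        simp
      have h2 := self_eq_neg.1 h
      exact h2 }

theorem altOf_apply {M N : ℕ} (G : (Fin N → Fin M) → ℂ) (hG) (y : Fin N → Fin M → ℂ) :
    altOf G hG y = ∑ ρ, (∏ t, y t (ρ t)) * G ρ := by
  change (∑ ρ : Fin N → Fin M, G ρ • (MultilinearMap.mkPiAlgebra ℂ (Fin N) ℂ).compLinearMap
      (fun t => (LinearMap.proj (ρ t) : (Fin M → ℂ) →ₗ[ℂ] ℂ))) y = _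
  simp [mul_comm]

theorem altOf_single {M N : ℕ} (G : (Fin N → Fin M) → ℂ) (hG) (ρ : Fin N → Fin M) :
    altOf G hG (fun t => Pi.single (ρ t) 1) = G ρ := by
  rw [altOf_apply, Finset.sum_eq_single ρ]
  · simp
  · intro ρ' _ h
    obtain ⟨t, ht⟩ := Function.ne_iff.1 h
    rw [Finset.prod_eq_zero (Finset.mem_univ t), zero_mul]
    simp [ht]
  · simp

theorem altOf_cons {M q : ℕ} (w : (Fin (q+1) → Fin M) → MvPolynomial (Fin M) ℂ)
    (hlin : ∀ σ, (w σ).IsHomogeneous 1) (hG) (x : Fin M → ℂ) (y : Fin (q+1) → Fin M → ℂ) :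
    altOf (gFun w) hG (Fin.cons x y) = ∑ σ, (∏ t, y t (σ t)) * eval x (w σ) := by
  rw [altOf_apply, ← (Fin.consEquiv (fun _ : Fin (q+2) => Fin M)).sum_comp,
    Fintype.sum_prod_type, Finset.sum_comm]
  refine Finset.sum_congr rfl fun σ _ => ?_
  rw [lin_eval (hlin _), Finset.mul_sum]
  refine Finset.sum_congr rfl fun i _ => ?_
  rw [Fin.prod_univ_succ]
  simp [Fin.consEquiv, gFun]
  ring

theorem altOf_cons_single {M q : ℕ} (w : (Fin (q+1) → Fin M) → MvPolynomial (Fin M) ℂ)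
    (hlin : ∀ σ, (w σ).IsHomogeneous 1) (hG) (x : Fin M → ℂ) (τ : Fin (q+1) → Fin M) :
    altOf (gFun w) hG (Fin.cons x (fun t => Pi.single (τ t) 1)) = eval x (w τ) := by
  rw [altOf_cons w hlin, Finset.sum_eq_single τ]
  · simp
  · intro ρ' _ h
    obtain ⟨t, ht⟩ := Function.ne_iff.1 h
    rw [Finset.prod_eq_zero (Finset.mem_univ t), zero_mul]
    simp [ht]
  · simp

theorem eval_contr {M q : ℕ} (w : (Fin (q+1) → Fin M) → MvPolynomial (Fin M) ℂ)
    (hlin : ∀ σ, (w σ).IsHomogeneous 1) (hG) (x : Fin M → ℂ) (u : Fin q → Fin M → ℂ) (j : Fin M) :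
    eval x (contrConsts w u j) = altOf (gFun w) hG (Fin.cons x (Fin.snoc u (Pi.single j 1))) := by
  rw [altOf_cons w hlin, contrConsts, formEval, map_sum]
  refine Finset.sum_congr rfl fun σ _ => ?_
  rw [map_mul, map_prod]
  congr 1
  refine Finset.prod_congr rfl fun t _ => ?_
  refine Fin.lastCases ?_ (fun t => ?_) t
  · simp only [Fin.snoc_last, Pi.single_apply]
    split_ifs <;> simp
  · simp

theorem eval_dCoeff {M q : ℕ} (w : (Fin (q+1) → Fin M) → MvPolynomial (Fin M) ℂ)
    (hlin : ∀ σ, (w σ).IsHomogeneous 1) (hG) (x : Fin M → ℂ) (ρ : Fin (q+2) → Fin M) :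
    eval x (dCoeff w ρ) = (q + 2 : ℂ) * altOf (gFun w) hG (fun t => Pi.single (ρ t) 1) := by
  have key : ∀ s : Fin (q+2), eval x ((-1 : MvPolynomial (Fin M) ℂ) ^ (s : ℕ)
    * pderiv (ρ s) (w (fun t => ρ (s.succAbove t)))) =
      altOf (gFun w) hG (fun t => Pi.single (ρ t) 1) := by
    intro s
    have h := (altOf (gFun w) hG).map_insertNth s (Pi.single (ρ s) 1)
      (fun t => Pi.single (ρ (s.succAbove t)) 1)
    have e1 : (s.insertNth (Pi.single (ρ s) 1) (fun t => Pi.single (ρ (s.succAbove t)) 1) :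
        Fin (q+2) → Fin M → ℂ) = fun t => Pi.single (ρ t) 1 :=
      Fin.insertNth_self_removeNth s (fun t => (Pi.single (ρ t) 1 : Fin M → ℂ))
    have e2 : (Matrix.vecCons (Pi.single (ρ s) 1) (fun t => Pi.single (ρ (s.succAbove t)) 1) :
        Fin (q+2) → Fin M → ℂ) = fun t => Pi.single
          ((Fin.cons (ρ s) (fun t => ρ (s.succAbove t)) : Fin (q+2) → Fin M) t) 1 := by
      funext t
      refine Fin.cases ?_ (fun t => ?_) t <;> simp
    rw [e1, e2, altOf_single (gFun w) hG (Fin.cons _ _)] at h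
    rw [h, lin_pderiv (hlin _)]
    simp [gFun]
  rw [dCoeff, map_sum, Finset.sum_congr rfl fun s _ => key s]
  simp

theorem wedge_ext {M N : ℕ} (α : (Fin M → ℂ) →ₗ[ℂ] ℂ) (ψ : (Fin M → ℂ) [⋀^Fin N]→ₗ[ℂ] ℂ)
    (h : ∀ τ : Fin (N+1) → Fin M, ∑ s : Fin (N+1), (-1 : ℂ)^(s:ℕ) * α (Pi.single (τ s) 1) *
      ψ (fun t => Pi.single (τ (s.succAbove t)) 1) = 0) (b : Fin (N+1) → Fin M → ℂ) :
    ∑ s : Fin (N+1), (-1 : ℂ)^(s:ℕ) * α (b s) * ψ (fun t => b (s.succAbove t)) = 0 := by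
  have hap : ∀ b, AlternatingMap.alternatizeUncurryFin (α.smulRight ψ) b =
      ∑ s : Fin (N+1), (-1 : ℂ)^(s:ℕ) * α (b s) * ψ (fun t => b (s.succAbove t)) := by
    intro b
    rw [AlternatingMap.alternatizeUncurryFin_apply]
    refine Finset.sum_congr rfl fun s _ => ?_
    simp only [LinearMap.smulRight_apply, AlternatingMap.smul_apply, smul_eq_mul,
      zsmul_eq_mul, mul_assoc]
    push_cast
    rfl
  have hz : AlternatingMap.alternatizeUncurryFin (α.smulRight ψ) = 0 := by
    refine Basis.ext_alternating (Pi.basisFun ℂ (Fin M)) ?_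
    intro c _
    rw [hap, AlternatingMap.zero_apply, ← h c]
    simp
  rw [← hap, hz, AlternatingMap.zero_apply]

end transl

/-- Proposition 2.5 of the paper.  Let `n ≥ 3`, `2 ≤ q ≤ n − 1`
(here `q = q' + 2`).  Let `ω` be a nonzero polynomial `q`-form on `ℂ^{n+1}` with
homogeneous linear coefficients such that: (i) `ι_𝓡 ω = 0`; (ii) the ideal of
coefficients of `ω` has height `≥ 2`; (iii) `(ι_{u₁}⋯ι_{u_{q−1}}ω) ∧ ω = 0` for all
constant vectors `u₁,…,u_{q−1}` (local decomposability).  Then `ω` is integrable: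
`(ι_{u₁}⋯ι_{u_{q−1}}ω) ∧ dω = 0` for all constant vectors.
(Every degree-zero distribution of codimension `q ≥ 2` on `ℙⁿ` is integrable.) -/
theorem degree_zero_distribution_is_integrable (n q' : ℕ) (hn : 3 ≤ n)
    (hq : q' + 2 ≤ n - 1)
    (w : (Fin (q' + 2) → Fin (n + 1)) → MvPolynomial (Fin (n + 1)) ℂ)
    (hw0 : w ≠ 0)
    (halt : FormIsAlt w)
    (hlin : ∀ σ, (w σ).IsHomogeneous 1)
    (hrad : ∀ τ : Fin (q' + 2) → Fin (n + 1),
      ∑ i, X i * w (Function.update τ 0 i) = 0)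
    (hht : 2 ≤ idealHeight (Ideal.span (Set.range w)))
    (hlds : ∀ u : Fin (q' + 1) → (Fin (n + 1) → ℂ),
      ∀ τ : Fin (q' + 3) → Fin (n + 1),
        ∑ s : Fin (q' + 3), (-1 : MvPolynomial (Fin (n + 1)) ℂ) ^ (s : ℕ)
          * contrConsts w u (τ s) * w (fun t => τ (s.succAbove t)) = 0) :
    ∀ u : Fin (q' + 1) → (Fin (n + 1) → ℂ),
      ∀ τ : Fin (q' + 4) → Fin (n + 1),
        ∑ s : Fin (q' + 4), (-1 : MvPolynomial (Fin (n + 1)) ℂ) ^ (s : ℕ)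
          * contrConsts w u (τ s) * dCoeff w (fun t => τ (s.succAbove t)) = 0 := by
  have hG := gFun_perm w halt hlin hrad
  have H : Pl q' (altOf (gFun w) hG) := by
    intro x u b
    let Ω := altOf (gFun w) hG
    let α : (Fin (n+1) → ℂ) →ₗ[ℂ] ℂ :=
      Ω.toMultilinearMap.toLinearMap (Fin.cons x (Fin.snoc u 0)) (Fin.last _)
    have hαy : ∀ y, α y = Ω (Fin.cons x (Fin.snoc u y)) := by
      intro y
      simp only [α, MultilinearMap.toLinearMap_apply]
      change Ω _ = _
      congr 1
      rw [← Fin.succ_last, ← Fin.cons_update, Fin.update_snoc_last]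
    have := wedge_ext α (Ω.curryLeft x) (by
      intro τ
      have h := congrArg (eval x) (hlds u τ)
      rw [map_sum, map_zero] at h
      rw [← h]
      refine Finset.sum_congr rfl fun s _ => ?_
      rw [map_mul, map_mul, eval_contr w hlin hG, hαy, ← altOf_cons_single w hlin hG]
      simp only [map_pow, map_neg, map_one]
      rfl) b
    simp only [hαy] at this
    exact this
  intro u τ
  refine MvPolynomial.funext fun x => ?_
  have h := core H x u (fun s => Pi.single (τ s) 1)
  rw [map_sum, map_zero]
  rw [← mul_zero ((q' + 1 : ℕ) + 2 : ℂ), ← h, Finset.mul_sum]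
  refine Finset.sum_congr rfl fun s _ => ?_
  rw [map_mul, map_mul, eval_contr w hlin hG, eval_dCoeff w hlin hG]
  simp only [map_pow, map_neg, map_one]
  ring

end DegZeroDistributions
end

section
/- Let n ≥ 3 and 2 ≤ q ≤ n − 1. Let ω be a nonzero polynomial q-form on ℂ^{n+1} whose coefficients are homogeneous of degree 1, satisfying: (i) ι_𝓡 ω = 0; (ii) the ideal generated by the coefficients of ω has height at least 2; (iii) (ι_{u₁}⋯ι_{u_{q−1}} ω) ∧ ω = 0 for all constant vectors u₁,…,u_{q−1} ∈ ℂ^{n+1}. Then there exist ℂ-linearly independent linear forms ℓ₀,…,ℓ_q ∈ ℂ[x₀,…,x_n] such that ω = ι_𝓡(dℓ₀ ∧ dℓ₁ ∧ ⋯ ∧ dℓ_q). (Equivalently: up to a linear change of homogeneous coordinates and a scalar, every degree-zero distribution of codimension q ≥ 2 on ℙⁿ is ι_𝓡(dx₀∧⋯∧dx_q).) -/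
open MvPolynomial

noncomputable section DegZeroDistributionsNormalForm

theorem dz_perm {k : ℕ} (i j : Fin (k+3)) (hij : i ≠ j) :
    ∃ π : Equiv.Perm (Fin (k+3)), π 0 = i ∧ π (Fin.last _) = j := by
  refine ⟨Equiv.swap 0 i * Equiv.swap (Fin.last _) (Equiv.swap 0 i j), ?_, ?_⟩
  · have h : Equiv.swap (Fin.last _) (Equiv.swap 0 i j) (0 : Fin (k+3)) = 0 := by
      apply Equiv.swap_apply_of_ne_of_ne
      · exact (Fin.last_pos).ne
      · intro h
        have := congrArg (Equiv.swap 0 i) h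
        simp at this
        exact hij this
    rw [Equiv.Perm.mul_apply, h, Equiv.swap_apply_left]
  · simp

section core
variable {V : Type*} [AddCommGroup V] [Module ℂ V] {k : ℕ}

theorem dz_tuple (Ω : V [⋀^Fin (k+3)]→ₗ[ℂ] ℂ) (e : Fin (k+3) → V) (i j : Fin (k+3)) (hij : i ≠ j) :
    ∃ (u : Fin (k+1) → V) (c : ℂ), c ≠ 0 ∧ ∀ y, Ω (Fin.cons (e i) (Fin.snoc u y : Fin (k+2) → V)) =
      c * Ω (Function.update e j y) := by
  obtain ⟨π, h0, hl⟩ := dz_perm i j hij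
  refine ⟨fun t => e (π t.castSucc.succ), ((Equiv.Perm.sign π : ℤ) : ℂ), ?_, ?_⟩
  · rcases Int.units_eq_one_or (Equiv.Perm.sign π) with h | h <;> simp [h]
  · intro y
    have : (Fin.cons (e i) (Fin.snoc (fun t : Fin (k+1) => e (π t.castSucc.succ)) y : Fin (k+2) → V) : Fin (k+3) → V)
        = Function.update e j y ∘ π := by
      funext t
      refine Fin.cases ?_ (fun t => ?_) t
      · simp [h0, Function.update_of_ne hij]
      · refine Fin.lastCases ?_ (fun t => ?_) t
        · simp [hl]
        · have : π t.castSucc.succ ≠ j := by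
            rw [← hl]; intro h
            have := π.injective h
            rw [← Fin.succ_last, Fin.succ_inj] at this
            exact (Fin.castSucc_lt_last t).ne this
          simp [Function.update_of_ne this]
    rw [this, AlternatingMap.map_perm]
    rw [Units.smul_def, zsmul_eq_mul]

variable (Ω : V [⋀^Fin (k+3)]→ₗ[ℂ] ℂ)
  (H : ∀ (x : V) (u : Fin (k+1) → V) (z : Fin (k+3) → V),
    ∑ s : Fin (k+3), (-1 : ℂ) ^ (s : ℕ) * Ω (Fin.cons x (Fin.snoc u (z s) : Fin (k+2) → V)) *
      Ω (Fin.cons x (fun t => z (s.succAbove t))) = 0)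
  (e : Fin (k+3) → V) (he : Ω e = 1)

include he in
theorem dz_upd_self (j : Fin (k+3)) : Ω (Function.update e j (e j)) = 1 := by simpa using he

theorem dz_upd_ne (j l : Fin (k+3)) (h : l ≠ j) : Ω (Function.update e j (e l)) = 0 :=
  Ω.map_update_self e h.symm

include he in
theorem dz_inj : Function.Injective e := by
  by_contra h
  have := Ω.map_eq_zero_of_not_injective e h
  simp [he] at this

def DzU (Ω : V [⋀^Fin (k+3)]→ₗ[ℂ] ℂ) (e : Fin (k+3) → V) (y : V) : Prop :=
  ∀ j, Ω (Function.update e j y) = 0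

include H he in
theorem dz_step1 (v : Fin (k+3) → V) (hv : ∀ t, (∃ j, v t = e j) ∨ DzU Ω e (v t))
    (a b : Fin (k+3)) (ha : ∃ i, v a = e i) (hb : DzU Ω e (v b)) : Ω v = 0 := by
  obtain ⟨i, hi⟩ := ha
  have hj : ∃ j, ∀ t, v t ≠ e j := by
    by_contra! h
    choose g hg using h
    have ginj : Function.Injective g := by
      intro x y hxy
      apply dz_inj Ω e he
      rw [← hg, ← hg, hxy]
    obtain ⟨j, rfl⟩ := (Finite.injective_iff_surjective.1 ginj) b
    have := hb j
    rw [hg, dz_upd_self Ω e he] at this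
    exact one_ne_zero this
  obtain ⟨j, hj⟩ := hj
  have hij : i ≠ j := by rintro rfl; exact hj a hi
  have hz : ∀ t, Ω (Function.update e j (v t)) = 0 := by
    intro t
    rcases hv t with ⟨l, hl⟩ | h
    · rw [hl]; apply dz_upd_ne
      rintro rfl; exact hj t hl
    · exact h j
  obtain ⟨u, c, hc, hu⟩ := dz_tuple Ω e i j hij
  have h1 := H (e i) u (Fin.cons (e j) (fun t => v (a.succAbove t)))
  rw [Fin.sum_univ_succ] at h1
  simp only [hu, Fin.cons_succ, hz, Fin.cons_zero, dz_upd_self Ω e he, Fin.succAbove_zero] at h1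
  simp [hc] at h1
  rw [← hi] at h1
  have h2 : (Fin.cons (v a) (fun t => v (a.succAbove t)) : Fin (k+3) → V) = v ∘ a.cycleRange.symm := by
    funext t
    refine Fin.cases ?_ (fun t => ?_) t <;> simp
  rw [h2, AlternatingMap.map_perm, smul_eq_zero_iff_eq] at h1
  exact h1

theorem dz_cons_add (x y : V) (r : Fin (k+2) → V) :
    Ω (Fin.cons (x+y) r) = Ω (Fin.cons x r) + Ω (Fin.cons y r) := 
  Ω.toMultilinearMap.cons_add r x y

include H he in
theorem dz_step2 (v : Fin (k+3) → V) (hv : ∀ t, DzU Ω e (v t)) : Ω v = 0 := by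
  have h1 := H (e 0 + v 0) (fun t => e t.castSucc.succ) (Fin.cons (e (Fin.last _)) (fun t => v t.succ))
  rw [Fin.sum_univ_succ] at h1
  have A : ∀ y, Ω (Fin.cons (e 0) (Fin.snoc (fun t : Fin (k+1) => e t.castSucc.succ) y : Fin (k+2) → V)) 
     = Ω (Function.update e (Fin.last _) y) := by
    intro y
    congr 1
    funext t
    refine Fin.cases ?_ (fun t => ?_) t
    · simp [Function.update_of_ne (Fin.last_pos (n := k+1)).ne]
    · refine Fin.lastCases ?_ (fun t => ?_) t
      · simp
      · have : t.castSucc.succ ≠ Fin.last _ := by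
          rw [← Fin.succ_last, Ne, Fin.succ_inj]
          exact (Fin.castSucc_lt_last t).ne
        simp [Function.update_of_ne this]
  have B : Ω (Fin.cons (v 0) (Fin.snoc (fun t : Fin (k+1) => e t.castSucc.succ) (e (Fin.last _)) : Fin (k+2) → V)) = 0 := by
    rw [← hv 0 0]
    congr 1
    funext t
    refine Fin.cases ?_ (fun t => ?_) t
    · simp
    · refine Fin.lastCases ?_ (fun t => ?_) t <;> simp
  have C : ∀ s, Ω (Fin.cons (v 0) (Fin.snoc (fun t : Fin (k+1) => e t.castSucc.succ) (v s) : Fin (k+2) → V)) = 0 := by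
    intro s
    apply dz_step1 Ω H e he _ _ (Fin.succ (Fin.castSucc 0)) 0
    · exact ⟨_, by simp only [Fin.cons_succ, Fin.snoc_castSucc]; rfl⟩
    · simpa using hv 0
    · intro t
      refine Fin.cases ?_ (fun t => ?_) t
      · right; simpa using hv 0
      · refine Fin.lastCases ?_ (fun t => ?_) t
        · right; simpa using hv s
        · left; simp
  have D : Ω (Fin.cons (e 0) (fun t => v t.succ)) = 0 := by
    apply dz_step1 Ω H e he _ _ 0 (Fin.succ 0)
    · simp
    · simpa using hv _
    · intro t
      refine Fin.cases ?_ (fun t => ?_) t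
      · left; simp
      · right; simpa using hv _
  have E : (Fin.cons (v 0) (fun t => v t.succ) : Fin (k+3) → V) = v := Fin.cons_self_tail v
  simp only [dz_cons_add, A, Fin.cons_succ, Fin.cons_zero, hv _ _, C, B, D, dz_upd_self Ω e he,
    Fin.succAbove_zero, E] at h1
  simpa using h1

/-- the coordinates -/
noncomputable def dzα (Ω : V [⋀^Fin (k+3)]→ₗ[ℂ] ℂ) (e : Fin (k+3) → V) : V →ₗ[ℂ] (Fin (k+3) → ℂ) :=
  LinearMap.pi fun s => Ω.toMultilinearMap.toLinearMap e s

theorem dzα_apply (y : V) (s) : dzα Ω e y s = Ω (Function.update e s y) := rfl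

include he in
theorem dzα_e (j s) : dzα Ω e (e j) s = if j = s then 1 else 0 := by
  rw [dzα_apply]
  split_ifs with h
  · subst h; exact dz_upd_self Ω e he _
  · exact dz_upd_ne Ω e _ _ h

include H he in
theorem dz_core (v : Fin (k+3) → V) :
    Ω v = Matrix.det (Matrix.of fun s t => dzα Ω e (v t) s) := by
  let D : V [⋀^Fin (k+3)]→ₗ[ℂ] ℂ := (Matrix.detRowAlternating).compLinearMap (dzα Ω e)
  have hD : ∀ v, D v = Matrix.det (Matrix.of fun s t => dzα Ω e (v t) s) := by
    intro v
    rw [← Matrix.det_transpose]; rfl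
  rw [← hD]
  have hDe : D e = 1 := by
    rw [hD, ← Matrix.det_one (n := Fin (k+3)) (R := ℂ)]
    congr 1
    ext s t
    simp [dzα_e Ω e he, Matrix.one_apply, eq_comm]
  let S : Set V := {y | (∃ j, y = e j) ∨ DzU Ω e y}
  have hS : ⊤ ≤ Submodule.span ℂ S := by
    intro y _
    have : y = ∑ j, dzα Ω e y j • e j + (y - ∑ j, dzα Ω e y j • e j) := by abel
    rw [this]
    refine Submodule.add_mem _ (Submodule.sum_mem _ fun j _ => Submodule.smul_mem _ _ (Submodule.subset_span (Or.inl ⟨j, rfl⟩))) (Submodule.subset_span (Or.inr ?_))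
    intro s
    rw [← dzα_apply, map_sub, map_sum]
    simp [dzα_e Ω e he]
  let b := Module.Basis.ofSpan hS
  have key : Ω = D := by
    apply Module.Basis.ext_alternating b
    intro g hg
    have hm : ∀ t, b (g t) ∈ S := fun t => Module.Basis.ofSpan_subset hS ⟨_, rfl⟩
    set v := fun t => b (g t) with hvdef
    have hinj : Function.Injective v := b.injective.comp hg
    by_cases hU : ∃ t, DzU Ω e (v t)
    · obtain ⟨t, ht⟩ := hU
      have h1 : Ω v = 0 := by
        by_cases hE : ∃ a i, v a = e i
        · obtain ⟨a, ha⟩ := hE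
          exact dz_step1 Ω H e he v hm a t ha ht
        · push Not at hE
          apply dz_step2 Ω H e he v
          intro s
          rcases hm s with ⟨j, hj⟩ | h
          · exact absurd hj (hE _ _)
          · exact h
      rw [h1, hD]
      symm
      apply Matrix.det_eq_zero_of_column_eq_zero t
      intro s
      exact ht s
    · push Not at hU
      have : ∀ t, ∃ j, v t = e j := fun t => (hm t).resolve_right (hU t)
      choose p hp using this
      have pinj : Function.Injective p := by
        intro x y hxy
        apply hinj
        rw [hp, hp, hxy]
      let π : Equiv.Perm (Fin (k+3)) := Equiv.ofBijective p (Finite.injective_iff_bijective.1 pinj)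
      have hv : v = e ∘ π := funext hp
      rw [hv, AlternatingMap.map_perm, AlternatingMap.map_perm, he, hDe]
  rw [← key]

end core

theorem dz_lin {N : ℕ} (p : MvPolynomial (Fin N) ℂ) (hp : p.IsHomogeneous 1) :
    p = ∑ i, X i * C (coeff (Finsupp.single i 1) p) := by
  ext d
  simp only [coeff_sum, mul_comm (X _), coeff_C_mul, coeff_X]
  by_cases hd : d.degree = 1
  · obtain ⟨i, rfl⟩ : ∃ i, Finsupp.single i 1 = d := by
      have hd0 : d ≠ 0 := by rintro rfl; simp at hd
      obtain ⟨i, hi⟩ := Finsupp.ne_iff.1 hd0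
      refine ⟨i, ?_⟩
      have hle : Finsupp.single i 1 ≤ d := by
        rw [Finsupp.single_le_iff]
        exact Nat.one_le_iff_ne_zero.2 hi
      obtain ⟨c, rfl⟩ := exists_add_of_le hle
      rw [map_add, Finsupp.degree_single] at hd
      have : c = 0 := by
        rw [← Finsupp.degree_eq_zero_iff]; omega
      simp [this]
    simp [Finsupp.single_left_inj]
  · rw [hp.coeff_eq_zero hd]
    symm
    apply Finset.sum_eq_zero
    intro i _
    rw [if_neg, mul_zero]
    rintro rfl
    simp at hd

section part2
variable {N k : ℕ} (w : (Fin (k + 2) → Fin N) → MvPolynomial (Fin N) ℂ)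

def dzc (i : Fin N) (σ : Fin (k+2) → Fin N) : ℂ := coeff (Finsupp.single i 1) (w σ)

def dzΩc (ρ : Fin (k+3) → Fin N) : ℂ := dzc w (ρ 0) (fun t => ρ t.succ)

variable (halt : FormIsAlt w) (hlin : ∀ σ, (w σ).IsHomogeneous 1)
    (hrad : ∀ τ : Fin (k + 2) → Fin N, ∑ i, X i * w (Function.update τ 0 i) = 0)

include hlin in
theorem dz_eval (x : Fin N → ℂ) (σ) : eval x (w σ) = ∑ i, x i * dzc w i σ := by
  conv_lhs => rw [dz_lin (w σ) (hlin σ)]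
  simp [dzc]

include hlin hrad in
theorem dz_skew (τ : Fin (k + 2) → Fin N) (i j : Fin N) :
    dzc w i (Function.update τ 0 j) = - dzc w j (Function.update τ 0 i) := by
  have h : ∀ x : Fin N → ℂ, ∑ i, x i * ∑ j, x j * dzc w j (Function.update τ 0 i) = 0 := by
    intro x
    have := congrArg (eval x) (hrad τ)
    simpa [dz_eval w hlin] using this
  have h1 := h (Pi.single i 1)
  have h2 := h (Pi.single j 1)
  have h3 := h (Pi.single i 1 + Pi.single j 1)
  simp [Pi.single_apply, add_mul, Finset.sum_add_distrib] at h1 h2 h3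
  rw [h1, h2] at h3
  linear_combination h3

include halt hlin hrad in
theorem dz_swap (ρ : Fin (k+3) → Fin N) (x y : Fin (k+3)) (hxy : x ≠ y) :
    dzΩc w (ρ ∘ Equiv.swap x y) = - dzΩc w ρ := by
  have h01 : ∀ ρ : Fin (k+3) → Fin N, dzΩc w (ρ ∘ Equiv.swap 0 1) = - dzΩc w ρ := by
    intro ρ
    have h := dz_skew w hlin hrad (fun t => ρ t.succ) (ρ 1) (ρ 0)
    have e1 : Function.update (fun t : Fin (k+2) => ρ t.succ) 0 (ρ 1) = fun t => ρ t.succ := by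
      apply Function.update_eq_self_iff.2; rfl
    rw [e1] at h
    unfold dzΩc
    rw [← h]
    simp only [Function.comp_apply, Equiv.swap_apply_left]
    congr 1
    funext t
    refine Fin.cases ?_ (fun t => ?_) t
    · simp
    · rw [Function.update_of_ne (Fin.succ_ne_zero t), Equiv.swap_apply_of_ne_of_ne (Fin.succ_ne_zero _)]
      intro h; exact Fin.succ_ne_zero t (Fin.succ_injective _ h)
  have hss : ∀ (ρ : Fin (k+3) → Fin N) (a b : Fin (k+2)), a ≠ b →
      dzΩc w (ρ ∘ Equiv.swap a.succ b.succ) = - dzΩc w ρ := by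
    intro ρ a b hab
    unfold dzΩc dzc
    have e1 : (fun t : Fin (k+2) => (ρ ∘ Equiv.swap a.succ b.succ) t.succ) = (fun t => ρ t.succ) ∘ Equiv.swap a b := by
      funext t
      simp only [Function.comp_apply]
      rw [(Fin.succ_injective _).swap_apply]
    rw [e1, halt, Equiv.Perm.sign_swap hab]
    simp [Equiv.swap_apply_of_ne_of_ne (Fin.succ_ne_zero a).symm (Fin.succ_ne_zero b).symm]
  have h0s : ∀ (ρ : Fin (k+3) → Fin N) (b : Fin (k+2)),
      dzΩc w (ρ ∘ Equiv.swap 0 b.succ) = - dzΩc w ρ := by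
    intro ρ b
    by_cases hb : b = 0
    · subst hb; exact h01 ρ
    · have e1 : Equiv.swap (0 : Fin (k+3)) b.succ = Equiv.swap (Fin.succ 0) b.succ * Equiv.swap 0 1 * Equiv.swap (Fin.succ 0) b.succ := by
        rw [Equiv.mul_swap_eq_swap_mul _ 0 1, mul_assoc, Equiv.swap_mul_self, mul_one,
          Equiv.swap_apply_of_ne_of_ne (Fin.succ_ne_zero 0).symm (Fin.succ_ne_zero b).symm]
        congr 1
      have e2 : ρ ∘ Equiv.swap (0 : Fin (k+3)) b.succ = ((ρ ∘ Equiv.swap (Fin.succ 0) b.succ) ∘ Equiv.swap 0 1) ∘ Equiv.swap (Fin.succ 0) b.succ := by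
        rw [e1]; rfl
      rw [e2, hss _ _ _ (Ne.symm hb), h01, hss _ _ _ (Ne.symm hb)]
      ring
  induction x using Fin.cases with
  | zero =>
    induction y using Fin.cases with
    | zero => exact absurd rfl hxy
    | succ b => exact h0s ρ b
  | succ a =>
    induction y using Fin.cases with
    | zero => rw [Equiv.swap_comm]; exact h0s ρ a
    | succ b => exact hss ρ a b (fun h => hxy (by rw [h]))

def dzM : MultilinearMap ℂ (fun _ : Fin (k+3) => Fin N → ℂ) ℂ :=
  ∑ ρ : Fin (k+3) → Fin N, dzΩc w ρ • 
    (MultilinearMap.mkPiAlgebra ℂ (Fin (k+3)) ℂ).compLinearMap (fun t => LinearMap.proj (ρ t))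

theorem dzM_apply (v) : dzM w v = ∑ ρ : Fin (k+3) → Fin N, dzΩc w ρ * ∏ t, v t (ρ t) := by
  simp [dzM]

include halt hlin hrad in
theorem dzM_alt (v : Fin (k+3) → Fin N → ℂ) (i j) (h : v i = v j) (hij : i ≠ j) : dzM w v = 0 := by
  have h1 : dzM w v = - dzM w v := by
    conv_lhs => rw [dzM_apply]
    rw [dzM_apply, ← Finset.sum_neg_distrib]
    apply Fintype.sum_equiv (Equiv.arrowCongr (Equiv.swap i j) (Equiv.refl _))
    intro ρ
    have e1 : (Equiv.arrowCongr (Equiv.swap i j) (Equiv.refl (Fin N))) ρ = ρ ∘ Equiv.swap i j := by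
      funext t; simp [Equiv.arrowCongr]
    rw [e1, dz_swap w halt hlin hrad ρ i j hij, neg_mul, neg_neg]
    congr 1
    apply Fintype.prod_equiv (Equiv.swap i j)
    intro t
    simp only [Function.comp_apply, Equiv.swap_apply_self]
    refine congrFun ?_ _
    rcases eq_or_ne t i with rfl | hi
    · simp [h]
    · rcases eq_or_ne t j with rfl | hj
      · simp [h]
      · rw [Equiv.swap_apply_of_ne_of_ne hi hj]
  linear_combination (1/2) * h1

def dzΩ : (Fin N → ℂ) [⋀^Fin (k+3)]→ₗ[ℂ] ℂ :=
  { dzM w with map_eq_zero_of_eq' := fun v i j h hij => dzM_alt w halt hlin hrad v i j h hij }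

theorem dzΩ_apply (v) : dzΩ w halt hlin hrad v = ∑ ρ : Fin (k+3) → Fin N, dzΩc w ρ * ∏ t, v t (ρ t) :=
  dzM_apply w v

theorem dzΩ_cons (x : Fin N → ℂ) (r : Fin (k+2) → Fin N → ℂ) :
    dzΩ w halt hlin hrad (Fin.cons x r) = ∑ σ : Fin (k+2) → Fin N, (∏ t, r t (σ t)) * eval x (w σ) := by
  rw [dzΩ_apply, ← (Fin.consEquiv (fun _ : Fin (k+3) => Fin N)).sum_comp, Fintype.sum_prod_type_right]
  refine Finset.sum_congr rfl fun σ _ => ?_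
  rw [dz_eval w hlin, Finset.mul_sum]
  refine Finset.sum_congr rfl fun i _ => ?_
  rw [Fin.prod_univ_succ]
  simp [dzΩc, Fin.consEquiv]
  ring

theorem dzΩ_cons_single (x : Fin N → ℂ) (σ : Fin (k+2) → Fin N) :
    dzΩ w halt hlin hrad (Fin.cons x (fun t => Pi.single (σ t) 1)) = eval x (w σ) := by
  rw [dzΩ_cons, Finset.sum_eq_single σ]
  · simp
  · intro τ _ h
    obtain ⟨t, ht⟩ := Function.ne_iff.1 h
    rw [Finset.prod_eq_zero (Finset.mem_univ t), zero_mul]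
    simp [ht]
  · simp

theorem dzΩ_contr (x : Fin N → ℂ) (u : Fin (k+1) → Fin N → ℂ) (j : Fin N) :
    eval x (contrConsts w u j) = dzΩ w halt hlin hrad (Fin.cons x (Fin.snoc u (Pi.single j 1) : Fin (k+2) → Fin N → ℂ)) := by
  rw [dzΩ_cons, contrConsts, formEval, map_sum]
  refine Finset.sum_congr rfl fun σ _ => ?_
  rw [map_mul, map_prod]
  congr 1
  refine Finset.prod_congr rfl fun t _ => ?_
  refine Fin.lastCases ?_ (fun t => ?_) t
  · simp only [Fin.snoc_last, Pi.single_apply]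
    split_ifs <;> simp
  · simp

theorem dzΩ_lin (x : Fin N → ℂ) (u : Fin (k+1) → Fin N → ℂ) (y : Fin N → ℂ) :
    dzΩ w halt hlin hrad (Fin.cons x (Fin.snoc u y : Fin (k+2) → Fin N → ℂ)) =
      ∑ j, y j * dzΩ w halt hlin hrad (Fin.cons x (Fin.snoc u (Pi.single j 1) : Fin (k+2) → Fin N → ℂ)) := by
  simp only [dzΩ_cons]
  simp only [Finset.mul_sum]
  rw [Finset.sum_comm]
  refine Finset.sum_congr rfl fun σ _ => ?_
  simp only [Fin.prod_univ_castSucc, Fin.snoc_castSucc, Fin.snoc_last, Pi.single_apply]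
  simp
  ring

theorem dz_H (hlds : ∀ u : Fin (k + 1) → (Fin N → ℂ),
      ∀ τ : Fin (k + 3) → Fin N,
        ∑ s : Fin (k + 3), (-1 : MvPolynomial (Fin N) ℂ) ^ (s : ℕ)
          * contrConsts w u (τ s) * w (fun t => τ (s.succAbove t)) = 0)
    (x : Fin N → ℂ) (u : Fin (k+1) → Fin N → ℂ) (z : Fin (k+3) → Fin N → ℂ) :
    ∑ s : Fin (k+3), (-1 : ℂ) ^ (s : ℕ) * dzΩ w halt hlin hrad (Fin.cons x (Fin.snoc u (z s) : Fin (k+2) → Fin N → ℂ)) *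
      dzΩ w halt hlin hrad (Fin.cons x (fun t => z (s.succAbove t))) = 0 := by
  have h1 : ∀ s : Fin (k+3), (-1 : ℂ) ^ (s : ℕ) * dzΩ w halt hlin hrad (Fin.cons x (Fin.snoc u (z s) : Fin (k+2) → Fin N → ℂ)) *
      dzΩ w halt hlin hrad (Fin.cons x (fun t => z (s.succAbove t))) = 
      ∑ τ : Fin (k+3) → Fin N, (∏ t, z t (τ t)) * ((-1 : ℂ) ^ (s : ℕ) * eval x (contrConsts w u (τ s)) * eval x (w (fun t => τ (s.succAbove t)))) := by
    intro s
    rw [dzΩ_lin, dzΩ_cons, ← (Fin.insertNthEquiv (fun _ : Fin (k+3) => Fin N) s).sum_comp, Fintype.sum_prod_type,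
      mul_assoc, Finset.sum_mul, Finset.mul_sum]
    refine Finset.sum_congr rfl fun i _ => ?_
    rw [Finset.mul_sum, Finset.mul_sum]
    refine Finset.sum_congr rfl fun σ _ => ?_
    rw [Fin.prod_univ_succAbove _ s, ← dzΩ_contr]
    simp [Fin.insertNthEquiv]
    ring
  rw [Finset.sum_congr rfl fun s _ => h1 s, Finset.sum_comm]
  apply Finset.sum_eq_zero
  intro τ _
  rw [← Finset.mul_sum]
  have := congrArg (eval x) (hlds u τ)
  simp only [map_sum, map_mul, map_pow, map_neg, map_one, map_zero] at this
  rw [this, mul_zero]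

end part2

/-- normal form in the proof of Proposition 2.5.  Let `n ≥ 3`,
`2 ≤ q ≤ n − 1` (here `q = q' + 2`).  Let `ω` be a nonzero polynomial `q`-form on `ℂ^{n+1}`
with homogeneous linear coefficients such that: (i) `ι_𝓡 ω = 0`; (ii) the coefficient ideal
has height `≥ 2`; (iii) `(ι_{u₁}⋯ι_{u_{q−1}}ω) ∧ ω = 0` for all constant vectors (local
decomposability).  Then there are `ℂ`-linearly independent linear forms `ℓ₀,…,ℓ_q`
(recorded by their coefficient vectors `ℓ s ∈ ℂ^{n+1}`) with
`ω = ι_𝓡(dℓ₀ ∧ dℓ₁ ∧ ⋯ ∧ dℓ_q)`; in coefficients, for every tuple `τ`,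
`w τ = Σ_i x_i · det M(i,τ)`, where `M(i,τ)` has rows indexed by `s = 0,…,q` and
columns `(ℓ s i, ℓ s (τ 0), …, ℓ s (τ (q−1)))`. -/
theorem degree_zero_distribution_normal_form (n q' : ℕ) (hn : 3 ≤ n)
    (hq : q' + 2 ≤ n - 1)
    (w : (Fin (q' + 2) → Fin (n + 1)) → MvPolynomial (Fin (n + 1)) ℂ)
    (hw0 : w ≠ 0)
    (halt : FormIsAlt w)
    (hlin : ∀ σ, (w σ).IsHomogeneous 1)
    (hrad : ∀ τ : Fin (q' + 2) → Fin (n + 1),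
      ∑ i, X i * w (Function.update τ 0 i) = 0)
    (hht : 2 ≤ idealHeight (Ideal.span (Set.range w)))
    (hlds : ∀ u : Fin (q' + 1) → (Fin (n + 1) → ℂ),
      ∀ τ : Fin (q' + 3) → Fin (n + 1),
        ∑ s : Fin (q' + 3), (-1 : MvPolynomial (Fin (n + 1)) ℂ) ^ (s : ℕ)
          * contrConsts w u (τ s) * w (fun t => τ (s.succAbove t)) = 0) :
    ∃ ℓ : Fin (q' + 3) → (Fin (n + 1) → ℂ), LinearIndependent ℂ ℓ ∧
      ∀ τ : Fin (q' + 2) → Fin (n + 1),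
        w τ = ∑ i : Fin (n + 1), X i * Matrix.det (Matrix.of
          fun (s t : Fin (q' + 3)) =>
            Fin.cons (C (ℓ s i) : MvPolynomial (Fin (n + 1)) ℂ)
              (fun t' : Fin (q' + 2) => C (ℓ s (τ t'))) t) := by
  let Ω := dzΩ w halt hlin hrad
  have hcoef : ∀ i τ, dzc w i τ = Ω (Fin.cons (Pi.single i 1) (fun t => Pi.single (τ t) 1)) := by
    intro i τ
    rw [dzΩ_cons_single, dz_eval w hlin]
    simp [Pi.single_apply]
  have hex : ∃ e, Ω e = 1 := by
    by_contra! h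
    have h0 : ∀ v, Ω v = 0 := by
      intro v
      by_contra hv
      apply h (Function.update v 0 ((Ω v)⁻¹ • v 0))
      rw [AlternatingMap.map_update_smul, Function.update_eq_self, smul_eq_mul, inv_mul_cancel₀ hv]
    apply hw0
    funext τ
    rw [dz_lin (w τ) (hlin τ)]
    apply Finset.sum_eq_zero
    intro i _
    have := hcoef i τ
    rw [h0] at this
    unfold dzc at this
    rw [this]; simp
  obtain ⟨e, he⟩ := hex
  have hcore := dz_core Ω (dz_H w halt hlin hrad hlds) e he
  let ℓ : Fin (q' + 3) → Fin (n+1) → ℂ := fun s i => dzα Ω e (Pi.single i 1) s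
  have hℓ : ∀ s y, dzα Ω e y s = ∑ i, y i * ℓ s i := by
    intro s y
    have h := LinearMap.pi_apply_eq_sum_univ (dzα Ω e) y
    rw [h, Finset.sum_apply]
    refine Finset.sum_congr rfl fun i _ => ?_
    simp only [Pi.smul_apply, smul_eq_mul, ℓ]
    have h2 : (fun j => if i = j then (1 : ℂ) else 0) = Pi.single i 1 := by
      funext j
      simp [Pi.single_apply, eq_comm]
    rw [h2]
  refine ⟨ℓ, ?_, ?_⟩
  · rw [Fintype.linearIndependent_iff]
    intro g hg j
    have h1 : ∑ s, g s * dzα Ω e (e j) s = 0 := by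
      simp only [hℓ, Finset.mul_sum]
      rw [Finset.sum_comm]
      apply Finset.sum_eq_zero
      intro i _
      have := congrFun hg i
      simp only [Finset.sum_apply, Pi.smul_apply, smul_eq_mul, Pi.zero_apply] at this
      calc _ = e j i * ∑ s, g s * ℓ s i := by
            rw [Finset.mul_sum]; exact Finset.sum_congr rfl fun s _ => by ring
        _ = 0 := by rw [this, mul_zero]
    simpa [dzα_e Ω e he] using h1
  · intro τ
    conv_lhs => rw [dz_lin (w τ) (hlin τ)]
    refine Finset.sum_congr rfl fun i _ => ?_
    congr 1
    change C (dzc w i τ) = _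
    rw [hcoef, hcore, RingHom.map_det]
    congr 1
    ext1 s t
    refine Fin.cases ?_ (fun t => ?_) t <;> simp [ℓ]

end DegZeroDistributionsNormalForm
end

section
/- Let f ∈ ℂ[x₀,…,x₄] be homogeneous of degree 3 whose partial derivatives ∂f/∂x₀,…,∂f/∂x₄ have no common zero in ℂ⁵ other than the origin. Let ω = Σᵢ Aᵢ dxᵢ be a polynomial 1-form on ℂ⁵ whose coefficients Aᵢ are homogeneous of degree 2 and which satisfies Σᵢ xᵢ Aᵢ = 0 (i.e., ι_𝓡 ω = 0). Suppose that the 3-form ω ∧ dω vanishes on the cone over X = V(f), i.e., there exist a polynomial 3-form α and a polynomial 2-form β on ℂ⁵ such that ω ∧ dω = f·α + df ∧ β. Then ω ∧ dω = 0. (This is the algebraic content of Theorem 5.4: every codimension-one foliation of degree one on a smooth cubic threefold X ⊂ ℙ⁴ extends to a degree-one codimension-one foliation on ℙ⁴.) -/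
open MvPolynomial

namespace CubicAux

lemma core_eigen {E : Type*} [AddCommGroup E] [Module ℂ E] [FiniteDimensional ℂ E]
    (T : E → E → E → ℂ)
    (hadd : ∀ a a' b c, T (a + a') b c = T a b c + T a' b c)
    (hsmul : ∀ (r : ℂ) a b c, T (r • a) b c = r * T a b c)
    (h12 : ∀ a b c, T a b c = T b a c) (h23 : ∀ a b c, T a b c = T a c b)
    (M : Module.End ℂ E)
    (hinv : ∀ a b c, T (M a) b c + T a (M b) c + T a b (M c) = 0)
    (hsm : ∀ x, x ≠ 0 → ∃ z, T x x z ≠ 0) (l : ℂ) (hl : M.HasEigenvalue l) :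
    M.HasEigenvalue (-2 * l) := by
  obtain ⟨x, hx⟩ := hl.exists_hasEigenvector
  obtain ⟨z, hz⟩ := hsm x hx.2
  by_contra hne
  have hinj : Function.Injective (M - algebraMap ℂ (Module.End ℂ E) (-2 * l)) := by
    rw [← LinearMap.ker_eq_bot]
    rw [Module.End.hasEigenvalue_iff, not_not, Module.End.eigenspace_def] at hne
    exact hne
  obtain ⟨y, rfl⟩ := (LinearMap.injective_iff_surjective.mp hinj) z
  apply hz
  have h := hinv x x y
  rw [hx.apply_eq_smul, hsmul, h12 x (l • x) y, hsmul] at h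
  have e : (M - algebraMap ℂ (Module.End ℂ E) (-2 * l)) y = M y + (2 * l) • y := by
    rw [LinearMap.sub_apply, Module.algebraMap_end_apply, sub_eq_add_neg, ← neg_smul]
    congr 2; ring
  rw [e, h23, h12, hadd, hsmul, h12, h23 x (M y) x, h12 y x x, h23 x y x]
  linear_combination h

lemma core_nilp {E : Type*} [AddCommGroup E] [Module ℂ E] [FiniteDimensional ℂ E]
    (M : Module.End ℂ E) (h : ∀ l, M.HasEigenvalue l → M.HasEigenvalue (-2 * l)) :
    IsNilpotent M := by
  have h0 : ∀ l, M.HasEigenvalue l → l = 0 := by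
    intro l hl
    by_contra hl0
    have hn : ∀ n : ℕ, M.HasEigenvalue ((-2) ^ n * l) := by
      intro n
      induction n with
      | zero => simpa using hl
      | succ k ih => have := h _ ih; rwa [← mul_assoc, ← pow_succ'] at this
    have hfin : Set.Finite {l | M.HasEigenvalue l} := by
      refine (Module.End.finite_spectrum M).subset ?_
      intro l hl
      exact Module.End.hasEigenvalue_iff_mem_spectrum.mp hl
    refine Set.infinite_of_injective_forall_mem (f := fun n : ℕ => ((-2 : ℂ)) ^ n * l) ?_ hn hfin
    intro a b hab
    have h1 : ((-2 : ℂ)) ^ a = (-2) ^ b := mul_right_cancel₀ hl0 hab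
    have h2 := congrArg norm h1
    rw [norm_pow, norm_pow, norm_neg, Complex.norm_ofNat] at h2
    exact pow_right_injective₀ (by norm_num) (by norm_num) h2
  have ht := Module.End.iSup_maxGenEigenspace_eq_top M
  have h1 : M.maxGenEigenspace 0 = ⊤ := by
    rw [eq_top_iff, ← ht]
    refine iSup_le fun l => ?_
    by_cases hl : l = 0
    · rw [hl]
    · have : M.maxGenEigenspace l = ⊥ := by
        by_contra hb
        apply hl
        apply h0
        apply Module.End.hasEigenvalue_of_hasGenEigenvalue (k := M.maxGenEigenspaceIndex l)
        rw [Module.End.HasGenEigenvalue, Module.End.HasUnifEigenvalue, ← Module.End.maxGenEigenspace_eq]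
        exact hb
      rw [this]; exact bot_le
  refine ⟨M.maxGenEigenspaceIndex 0, ?_⟩
  rw [Module.End.maxGenEigenspace_eq, Module.End.genEigenspace_nat] at h1
  simpa using LinearMap.ker_eq_top.mp h1

def P1 {E : Type*} (M : E → E) : Module.End ℂ (E → E → E → ℂ) where
  toFun F := fun a b c => F (M a) b c
  map_add' _ _ := rfl
  map_smul' _ _ := rfl
def P2 {E : Type*} (M : E → E) : Module.End ℂ (E → E → E → ℂ) where
  toFun F := fun a b c => F a (M b) c
  map_add' _ _ := rfl
  map_smul' _ _ := rfl
def P3 {E : Type*} (M : E → E) : Module.End ℂ (E → E → E → ℂ) where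
  toFun F := fun a b c => F a b (M c)
  map_add' _ _ := rfl
  map_smul' _ _ := rfl

lemma P1_pow {E : Type*} (M : E → E) (n : ℕ) (F : E → E → E → ℂ) (a b c : E) :
    ((P1 M) ^ n) F a b c = F (M^[n] a) b c := by
  induction n generalizing F with
  | zero => rfl
  | succ k ih => rw [pow_succ, Module.End.mul_apply, ih, Function.iterate_succ_apply']; rfl
lemma P2_pow {E : Type*} (M : E → E) (n : ℕ) (F : E → E → E → ℂ) (a b c : E) :
    ((P2 M) ^ n) F a b c = F a (M^[n] b) c := by
  induction n generalizing F with
  | zero => rfl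
  | succ k ih => rw [pow_succ, Module.End.mul_apply, ih, Function.iterate_succ_apply']; rfl
lemma P3_pow {E : Type*} (M : E → E) (n : ℕ) (F : E → E → E → ℂ) (a b c : E) :
    ((P3 M) ^ n) F a b c = F a b (M^[n] c) := by
  induction n generalizing F with
  | zero => rfl
  | succ k ih => rw [pow_succ, Module.End.mul_apply, ih, Function.iterate_succ_apply']; rfl

lemma core {E : Type*} [AddCommGroup E] [Module ℂ E] [FiniteDimensional ℂ E]
    (T : E → E → E → ℂ)
    (hadd : ∀ a a' b c, T (a + a') b c = T a b c + T a' b c)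
    (hsmul : ∀ (r : ℂ) a b c, T (r • a) b c = r * T a b c)
    (h12 : ∀ a b c, T a b c = T b a c) (h23 : ∀ a b c, T a b c = T a c b)
    (M : Module.End ℂ E)
    (hinv : ∀ a b c, T (M a) b c + T a (M b) c + T a b (M c) = 0)
    (hsm : ∀ x, x ≠ 0 → ∃ z, T x x z ≠ 0) : M = 0 := by
  have hnil := core_nilp M (core_eigen T hadd hsmul h12 h23 M hinv hsm)
  by_contra hM
  have hz : ∀ b c, T 0 b c = 0 := fun b c => by simpa using hsmul 0 0 b c
  have hz2 : ∀ b c, T b 0 c = 0 := fun b c => by rw [h12, hz]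
  have hz3 : ∀ b c, T b c 0 = 0 := fun b c => by rw [h23, hz2]
  -- the last nonzero power
  obtain ⟨m, hm, hm'⟩ : ∃ m : ℕ, M ^ (m + 1) ≠ 0 ∧ M ^ (m + 2) = 0 := by
    classical
    have hfind := Nat.find_spec hnil
    have hmin := fun k => Nat.find_min hnil (m := k)
    rcases hk : Nat.find hnil with _ | _ | m
    · rw [hk, pow_zero] at hfind
      exact absurd (by rw [← mul_one M, hfind, mul_zero]) hM
    · rw [hk, zero_add, pow_one] at hfind
      exact absurd hfind hM
    · rw [hk] at hfind hmin
      exact ⟨m, hmin _ (by omega), hfind⟩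
  obtain ⟨u, hu⟩ : ∃ u, (M ^ (m + 1)) u ≠ 0 := by
    by_contra! hcon
    exact hm (LinearMap.ext hcon)
  obtain ⟨c, hc⟩ := hsm _ hu
  apply hc
  have hit : ∀ n x, (M^[n]) x = (M ^ n) x := fun n x => by rw [Module.End.coe_pow]
  have hbig : ∀ n x, m + 2 ≤ n → (M ^ n) x = 0 := by
    intro n x hn
    obtain ⟨k, rfl⟩ := Nat.exists_eq_add_of_le hn
    rw [pow_add, hm', zero_mul]; rfl
  have hcomm : Commute (P1 (E := E) M) (P2 M) := rfl
  have hcomm3 : Commute (P1 (E := E) M + P2 M) (P3 M) := rfl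
  have hT : (P1 (E := E) M + P2 M) T = - (P3 M T) := by
    funext a b c
    have := hinv a b c
    change T (M a) b c + T a (M b) c = - T a b (M c)
    linear_combination this
  have hpow : ∀ n, ((P1 (E := E) M + P2 M) ^ n) T = (-1 : ℂ) ^ n • ((P3 M) ^ n) T := by
    intro n
    induction n with
    | zero => simp
    | succ k ih =>
      rw [pow_succ', Module.End.mul_apply, ih, map_smul, ← Module.End.mul_apply,
        (hcomm3.pow_right k).eq, Module.End.mul_apply, hT, map_neg, ← Module.End.mul_apply,
        ← pow_succ, pow_succ (-1 : ℂ)]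
      simp
  have key := congrFun (congrFun (congrFun (hpow (2 * (m + 1))) u) u) c
  rw [hcomm.add_pow] at key
  have hR : ((-1 : ℂ) ^ (2 * (m + 1)) • ((P3 (E := E) M) ^ (2 * (m + 1))) T) u u c = 0 := by
    change (-1 : ℂ) ^ (2 * (m + 1)) * (((P3 (E := E) M) ^ (2 * (m + 1))) T) u u c = 0
    rw [P3_pow, hit, hbig _ _ (by omega), hz3, mul_zero]
  rw [hR] at key
  rw [LinearMap.sum_apply, Finset.sum_apply, Finset.sum_apply, Finset.sum_apply] at key
  have hterm : ∀ k, ((P1 (E := E) M ^ k * P2 M ^ (2 * (m + 1) - k) *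
      ((2 * (m + 1)).choose k : Module.End ℂ (E → E → E → ℂ))) T) u u c =
      ((2 * (m + 1)).choose k : ℂ) * T ((M ^ k) u) ((M ^ (2 * (m + 1) - k)) u) c := by
    intro k
    rw [← Nat.cast_commute, ← nsmul_eq_mul, LinearMap.smul_apply]
    rw [← Nat.cast_smul_eq_nsmul ℂ]
    change _ * (((P1 (E := E) M ^ k * P2 M ^ (2 * (m + 1) - k)) T) u u c) = _
    rw [Module.End.mul_apply, P1_pow, P2_pow, hit, hit]
  simp only [hterm] at key
  rw [Finset.sum_eq_single (m + 1)] at key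
  · have e : 2 * (m + 1) - (m + 1) = m + 1 := by omega
    rw [e] at key
    rcases mul_eq_zero.mp key with h | h
    · exact absurd (Nat.cast_eq_zero.mp h) (Nat.choose_pos (by omega)).ne'
    · exact h
  · intro k _ hk
    rcases Nat.lt_or_ge k (m + 1) with h | h
    · rw [hbig (2 * (m + 1) - k) _ (by omega), hz2, mul_zero]
    · rw [hbig k _ (by omega), hz, mul_zero]
  · intro h
    exact absurd (Finset.mem_range.mpr (by omega)) h

lemma core2 {E : Type*} [AddCommGroup E] [Module ℂ E] [FiniteDimensional ℂ E]
    (T : E → E → E → ℂ)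
    (hadd : ∀ a a' b c, T (a + a') b c = T a b c + T a' b c)
    (hsmul : ∀ (r : ℂ) a b c, T (r • a) b c = r * T a b c)
    (h12 : ∀ a b c, T a b c = T b a c) (h23 : ∀ a b c, T a b c = T a c b)
    (M : Module.End ℂ E)
    (hinv : ∀ a, T (M a) a a = 0)
    (hsm : ∀ x, x ≠ 0 → ∃ z, T x x z ≠ 0) : M = 0 := by
  refine core T hadd hsmul h12 h23 M ?_ hsm
  intro a b c
  have hadd2 : ∀ a b b' c, T a (b + b') c = T a b c + T a b' c := fun a b b' c => by
    rw [h12, hadd, h12 b, h12 b']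
  have hadd3 : ∀ a b c c', T a b (c + c') = T a b c + T a b c' := fun a b c c' => by
    rw [h23, hadd2, h23 a c, h23 a c']
  have e1 := hinv (a + b + c)
  have e2 := hinv (a + b)
  have e3 := hinv (a + c)
  have e4 := hinv (b + c)
  simp only [map_add, hadd, hadd2, hadd3] at e1 e2 e3 e4
  rw [h12 a (M b) c, h23 a b (M c), h12 a (M c) b]
  have s1 := h23 (M a) b c
  have s2 := h23 (M b) a c
  have s3 := h23 (M c) a b
  linear_combination (1 / 2) * (e1 - e2 - e3 - e4 + hinv a + hinv b + hinv c + s1 + s2 + s3)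

abbrev R5 := MvPolynomial (Fin 5) ℂ

lemma hc_mul (p q : R5) (m n : ℕ) (hp : p.IsHomogeneous m) :
    homogeneousComponent (m + n) (p * q) = p * homogeneousComponent n q := by
  have h : ∀ i, homogeneousComponent (m + n) (p * homogeneousComponent i q)
      = if i = n then p * homogeneousComponent i q else 0 := by
    intro i
    rw [homogeneousComponent_of_mem (m := m + n) (n := m + i)
      (hp.mul (homogeneousComponent_isHomogeneous i q))]
    simp [eq_comm]
  conv_lhs => rw [← sum_homogeneousComponent q, Finset.mul_sum, map_sum]
  simp only [h]
  rw [Finset.sum_ite_eq']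
  split_ifs with hn
  · rfl
  · rw [homogeneousComponent_eq_zero, mul_zero]
    simpa using hn

lemma pderiv_cm (i j : Fin 5) (p : R5) : pderiv i (pderiv j p) = pderiv j (pderiv i p) := by
  have h : ⁅(pderiv i : Derivation ℂ R5 R5), (pderiv j : Derivation ℂ R5 R5)⁆ = 0 := by
    apply MvPolynomial.derivation_ext
    intro k
    simp only [Derivation.commutator_apply, pderiv_X, Pi.single_apply]
    split_ifs <;> simp
  have h2 := congrArg (fun D => D p) h
  simpa [Derivation.commutator_apply, sub_eq_zero] using h2

lemma homog_zero (p : R5) (hp : p.IsHomogeneous 0) : p = C (coeff 0 p) := by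
  rw [← homogeneousComponent_zero, homogeneousComponent_eq_self hp]

lemma homog_one (p : R5) (hp : p.IsHomogeneous 1) :
    p = ∑ j, C (coeff 0 (pderiv j p)) * X j := by
  have h := hp.sum_X_mul_pderiv
  rw [one_smul] at h
  conv_lhs => rw [← h]
  refine Finset.sum_congr rfl fun j _ => ?_
  conv_lhs => rw [homog_zero _ hp.pderiv]
  ring

lemma no_lin_syz (f : R5) (hf : f.IsHomogeneous 3)
    (hsm : ∀ a : Fin 5 → ℂ, a ≠ 0 → ∃ i, eval a (pderiv i f) ≠ 0)
    (l : Fin 5 → R5) (hl : ∀ i, (l i).IsHomogeneous 1)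
    (h : ∑ i, l i * pderiv i f = 0) (i : Fin 5) : l i = 0 := by
  let c : Fin 5 → Fin 5 → Fin 5 → ℂ := fun i j k => coeff 0 (pderiv i (pderiv j (pderiv k f)))
  have c12 : ∀ i j k, c i j k = c j i k := fun i j k => by simp only [c]; rw [pderiv_cm]
  have c23 : ∀ i j k, c i j k = c i k j := fun i j k => by simp only [c]; rw [pderiv_cm j k]
  let T : (Fin 5 → ℂ) → (Fin 5 → ℂ) → (Fin 5 → ℂ) → ℂ := fun x y z =>
    ∑ i, ∑ j, ∑ k, c i j k * (x i * y j * z k)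
  have hT : ∀ x y, T y x x = 2 * ∑ i, y i * eval x (pderiv i f) := by
    intro x y
    simp only [T]
    rw [Finset.mul_sum]
    refine Finset.sum_congr rfl fun i _ => ?_
    have e1 := congrArg (eval x) (hf.pderiv (i := i)).sum_X_mul_pderiv
    have e2 : ∀ j, eval x (pderiv j (pderiv i f)) = ∑ k, c i j k * x k := by
      intro j
      conv_lhs => rw [homog_one _ (hf.pderiv (i := i)).pderiv]
      rw [map_sum]
      refine Finset.sum_congr rfl fun k _ => ?_
      rw [map_mul, eval_C, eval_X]
      change c k j i * _ = _
      rw [c12, c23, c12]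
    simp only [map_sum, map_mul, eval_X, e2, nsmul_eq_mul, map_natCast] at e1
    have e3 : 2 * (y i * eval x (pderiv i f)) = y i * (((3 - 1 : ℕ) : ℂ) * eval x (pderiv i f)) := by
      norm_num; ring
    rw [e3, ← e1, Finset.mul_sum]
    refine Finset.sum_congr rfl fun j _ => ?_
    rw [Finset.mul_sum, Finset.mul_sum]
    refine Finset.sum_congr rfl fun k _ => ?_
    ring
  let m : Matrix (Fin 5) (Fin 5) ℂ := fun i j => coeff 0 (pderiv j (l i))
  have hm : ∀ x i, Matrix.toLin' m x i = eval x (l i) := by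
    intro x i
    conv_rhs => rw [homog_one _ (hl i)]
    rw [Matrix.toLin'_apply]
    change ∑ j, m i j * x j = _
    simp [m]
  have h12 : ∀ x y z, T x y z = T y x z := by
    intro x y z
    simp only [T]
    rw [Finset.sum_comm]
    refine Finset.sum_congr rfl fun i _ => Finset.sum_congr rfl fun j _ =>
      Finset.sum_congr rfl fun k _ => ?_
    rw [c12]; ring
  have h23 : ∀ x y z, T x y z = T x z y := by
    intro x y z
    simp only [T]
    refine Finset.sum_congr rfl fun i _ => ?_
    rw [Finset.sum_comm]
    refine Finset.sum_congr rfl fun j _ => Finset.sum_congr rfl fun k _ => ?_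
    rw [c23]; ring
  have hM : Matrix.toLin' m = 0 := by
    refine core2 T ?_ ?_ h12 h23 _ ?_ ?_
    · intro a a' b c'
      simp only [T, ← Finset.sum_add_distrib, Pi.add_apply]
      refine Finset.sum_congr rfl fun i _ => Finset.sum_congr rfl fun j _ =>
        Finset.sum_congr rfl fun k _ => ?_
      ring
    · intro r a b c'
      simp only [T, Finset.mul_sum, Pi.smul_apply, smul_eq_mul]
      refine Finset.sum_congr rfl fun i _ => Finset.sum_congr rfl fun j _ =>
        Finset.sum_congr rfl fun k _ => ?_
      ring
    · intro x
      rw [hT]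
      have := congrArg (eval x) h
      simp only [map_sum, map_mul, map_zero] at this
      simp only [hm, this, mul_zero]
    · intro x hx
      obtain ⟨i, hi⟩ := hsm x hx
      refine ⟨Pi.single i 1, ?_⟩
      rw [h23, h12, hT]
      simpa [Pi.single_apply] using hi
  have hm0 : m = 0 := by simpa using hM
  rw [homog_one _ (hl i)]
  refine Finset.sum_eq_zero fun j _ => ?_
  have : coeff 0 (pderiv j (l i)) = 0 := congrFun (congrFun hm0 i) j
  rw [this]; simp

lemma syz5 (f : R5) (hf : f.IsHomogeneous 3)
    (hsm : ∀ a : Fin 5 → ℂ, a ≠ 0 → ∃ i, eval a (pderiv i f) ≠ 0)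
    (a b c d e : Fin 5) (hae : e ≠ a) (hbe : e ≠ b) (hce : e ≠ c) (hde : e ≠ d)
    (la lb lc ld le : R5) (ha : la.IsHomogeneous 1) (hb : lb.IsHomogeneous 1)
    (hc : lc.IsHomogeneous 1) (hd : ld.IsHomogeneous 1) (he : le.IsHomogeneous 1)
    (h : la * pderiv a f + lb * pderiv b f + lc * pderiv c f + ld * pderiv d f
      + le * pderiv e f = 0) : le = 0 := by
  have hs : ∀ (x i : Fin 5) (l : R5), l.IsHomogeneous 1 →
      ((Pi.single x l : Fin 5 → R5) i).IsHomogeneous 1 := by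
    intro x i l hl
    by_cases hx : i = x
    · subst hx; simpa using hl
    · rw [Pi.single_eq_of_ne hx]; exact isHomogeneous_zero _ _ _
  have hsum : ∀ (x : Fin 5) (l : R5), ∑ i, (Pi.single x l : Fin 5 → R5) i * pderiv i f
      = l * pderiv x f := by
    intro x l
    rw [Finset.sum_eq_single x]
    · simp
    · intro i _ hi; rw [Pi.single_eq_of_ne hi, zero_mul]
    · simp
  have := no_lin_syz f hf hsm (fun i => (Pi.single a la : Fin 5 → R5) i
    + (Pi.single b lb : Fin 5 → R5) i + (Pi.single c lc : Fin 5 → R5) i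
    + (Pi.single d ld : Fin 5 → R5) i + (Pi.single e le : Fin 5 → R5) i)
    (fun i => ((((hs _ _ _ ha).add (hs _ _ _ hb)).add (hs _ _ _ hc)).add
      (hs _ _ _ hd)).add (hs _ _ _ he))
    (by simp only [add_mul, Finset.sum_add_distrib, hsum]; exact h) e
  simpa [Pi.single_eq_of_ne hae, Pi.single_eq_of_ne hbe, Pi.single_eq_of_ne hce,
    Pi.single_eq_of_ne hde] using this

lemma f_ne_zero (f : R5)
    (hsm : ∀ a : Fin 5 → ℂ, a ≠ 0 → ∃ i, eval a (pderiv i f) ≠ 0) : f ≠ 0 := by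
  rintro rfl
  obtain ⟨i, hi⟩ := hsm (fun _ => 1) (fun h => one_ne_zero (congrFun h 0))
  simp at hi

lemma pick2 : ∀ i j : Fin 5, ∃ k, k ≠ i ∧ k ≠ j := by decide
lemma pick3 : ∀ i j k : Fin 5, ∃ a e : Fin 5, a ≠ i ∧ a ≠ j ∧ a ≠ k ∧ e ≠ i ∧ e ≠ j ∧ e ≠ k
    ∧ a ≠ e := by decide

/-- Step 1: after contracting with the radial field, `β = -(1/3) ι_R α`. -/
lemma beta_eq (f : R5) (hf : f.IsHomogeneous 3)
    (hsm : ∀ a : Fin 5 → ℂ, a ≠ 0 → ∃ i, eval a (pderiv i f) ≠ 0)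
    (A : Fin 5 → R5) (hA : ∀ i, (A i).IsHomogeneous 2) (hrad : ∑ i, X i * A i = 0)
    (α : Fin 5 → Fin 5 → Fin 5 → R5) (b : Fin 5 → Fin 5 → R5)
    (hα : ∀ i j k, (α i j k).IsHomogeneous 0) (hb : ∀ i j, (b i j).IsHomogeneous 1)
    (hα2 : ∀ i j k, α i k j = - α i j k)
    (hbs : ∀ i j, b j i = - b i j)
    (h : ∀ i j k : Fin 5,
        A i * (pderiv j (A k) - pderiv k (A j))
          + A j * (pderiv k (A i) - pderiv i (A k))
          + A k * (pderiv i (A j) - pderiv j (A i))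
        = f * α i j k
          + (pderiv i f * b j k + pderiv j f * b k i + pderiv k f * b i j)) (j k : Fin 5) :
    ∑ i, X i * α i j k + 3 * b j k = 0 := by
  have eA : ∀ j, ∑ i, X i * pderiv i (A j) = 2 * A j := fun j => by
    rw [(hA j).sum_X_mul_pderiv]; simp
  have ef : ∑ i, X i * pderiv i f = 3 * f := by
    rw [hf.sum_X_mul_pderiv]; simp
  have eR : ∀ j, ∑ i, X i * pderiv j (A i) = - A j := fun j => by
    have := congrArg (pderiv j) hrad
    simp only [map_sum, Derivation.leibniz, smul_eq_mul, pderiv_X, map_zero,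
      Finset.sum_add_distrib] at this
    have e2 : ∑ i, A i * (Pi.single j 1 : Fin 5 → R5) i = A j := by
      rw [Finset.sum_eq_single j]
      · simp
      · intro i _ hi; rw [Pi.single_eq_of_ne hi, mul_zero]
      · simp
    have e3 : ∀ i, (Pi.single i 1 : Fin 5 → R5) j = (Pi.single j 1 : Fin 5 → R5) i := by
      intro i; simp [Pi.single_apply, eq_comm]
    try simp only [e3] at this
    linear_combination this - e2
  let η : Fin 5 → R5 := fun k => ∑ i, X i * b i k
  have key : ∀ j k, f * (∑ i, X i * α i j k + 3 * b j k)
      = pderiv j f * η k - pderiv k f * η j := by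
    intro j k
    have hs : ∑ i, X i * (A i * (pderiv j (A k) - pderiv k (A j))
          + A j * (pderiv k (A i) - pderiv i (A k))
          + A k * (pderiv i (A j) - pderiv j (A i)))
        = ∑ i, X i * (f * α i j k
          + (pderiv i f * b j k + pderiv j f * b k i + pderiv k f * b i j)) :=
      Finset.sum_congr rfl fun i _ => by rw [h i j k]
    have hl : ∑ i, X i * (A i * (pderiv j (A k) - pderiv k (A j))
          + A j * (pderiv k (A i) - pderiv i (A k))
          + A k * (pderiv i (A j) - pderiv j (A i)))
        = (∑ i, X i * A i) * (pderiv j (A k) - pderiv k (A j))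
          + A j * (∑ i, X i * pderiv k (A i) - ∑ i, X i * pderiv i (A k))
          + A k * (∑ i, X i * pderiv i (A j) - ∑ i, X i * pderiv j (A i)) := by
      simp only [Fin.sum_univ_five]; ring
    have hr : ∑ i, X i * (f * α i j k
          + (pderiv i f * b j k + pderiv j f * b k i + pderiv k f * b i j))
        = f * ∑ i, X i * α i j k + (∑ i, X i * pderiv i f) * b j k
          - pderiv j f * η k + pderiv k f * η j := by
      simp only [η, Fin.sum_univ_five, fun i => hbs i k]; ring
    rw [hl, hr, hrad, eR, eR, eA, eA, ef] at hs
    linear_combination - hs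
  have hγ : ∀ j k, (∑ i, X i * α i j k + 3 * b j k).IsHomogeneous 1 := by
    intro j k
    refine IsHomogeneous.add (IsHomogeneous.sum _ _ _ fun i _ =>
      (isHomogeneous_X _ i).mul (hα i j k)) ?_
    exact (hb j k).C_mul 3
  by_cases hjk : j = k
  · subst hjk
    have h1 : b j j = 0 := by
      have := hbs j j
      have h2 : (2 : R5) * b j j = 0 := by linear_combination this
      exact (mul_eq_zero.mp h2).resolve_left two_ne_zero
    have h3 : ∀ i, α i j j = 0 := fun i => by
      have := hα2 i j j
      have h2 : (2 : R5) * α i j j = 0 := by linear_combination this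
      exact (mul_eq_zero.mp h2).resolve_left two_ne_zero
    simp [h1, h3]
  obtain ⟨i, hij, hik⟩ := pick2 j k
  have z : (0 : R5).IsHomogeneous 1 := isHomogeneous_zero _ _ _
  refine syz5 f hf hsm j j j k i hij hij hij hik 0 0 (∑ l, X l * α l k i + 3 * b k i)
    (∑ l, X l * α l i j + 3 * b i j) (∑ l, X l * α l j k + 3 * b j k)
    z z (hγ k i) (hγ i j) (hγ j k) ?_
  apply mul_left_cancel₀ (f_ne_zero f hsm)
  linear_combination pderiv i f * key j k + pderiv j f * key k i + pderiv k f * key i j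

/-- Pfaffian of a 4 by 4 block. -/
noncomputable def Q (D : Fin 5 → Fin 5 → R5) (a b c d : Fin 5) : R5 :=
  D a b * D c d - D a c * D b d + D a d * D b c

/-- Step 2: `dω ∧ dω = 2 df ∧ α`. -/
lemma pf_eq (f : R5)
    (A : Fin 5 → R5)
    (α : Fin 5 → Fin 5 → Fin 5 → R5) (b : Fin 5 → Fin 5 → R5)
    (hα : ∀ i j k, (α i j k).IsHomogeneous 0)
    (hα1 : ∀ i j k, α j i k = - α i j k)
    (hα2 : ∀ i j k, α i k j = - α i j k)
    (hbs : ∀ i j, b j i = - b i j)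
    (hb : ∀ j k, ∑ i, X i * α i j k + 3 * b j k = 0)
    (h : ∀ i j k : Fin 5,
        A i * (pderiv j (A k) - pderiv k (A j))
          + A j * (pderiv k (A i) - pderiv i (A k))
          + A k * (pderiv i (A j) - pderiv j (A i))
        = f * α i j k
          + (pderiv i f * b j k + pderiv j f * b k i + pderiv k f * b i j)) (i j k l : Fin 5) :
    Q (fun i j => pderiv i (A j) - pderiv j (A i)) i j k l =
      pderiv i f * α j k l - pderiv j f * α i k l + pderiv k f * α i j l - pderiv l f * α i j k := by
  have dα : ∀ m i j k, pderiv m (α i j k) = 0 := fun m i j k => by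
    rw [homog_zero _ (hα i j k), pderiv_C]
  have db : ∀ m j k, 3 * pderiv m (b j k) = - α m j k := by
    intro m j k
    have := congrArg (pderiv m) (hb j k)
    have e3 : pderiv m (3 * b j k) = 3 * pderiv m (b j k) := by
      rw [show (3 : R5) = C 3 from rfl, pderiv_C_mul, C_mul']
    have e4 : ∑ i, pderiv m (X i * α i j k) = α m j k := by
      rw [Finset.sum_eq_single m]
      · simp [Derivation.leibniz, dα]
      · intro i _ hi; simp [Derivation.leibniz, dα, pderiv_X_of_ne hi]
      · simp
    rw [map_add, map_sum, e3, e4, map_zero] at this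
    linear_combination this
  have E : ∀ m i j k, _ := fun m i j k => congrArg (pderiv m) (h i j k)
  simp only [map_add, map_sub, Derivation.leibniz, smul_eq_mul, dα] at E
  have E1 := E i j k l
  have E2 := E j i k l
  have E3 := E k i j l
  have E4 := E l i j k
  simp only [Q]
  rw [hbs j l] at E1
  rw [hbs i l] at E2
  rw [hbs i l] at E3
  rw [hbs i k] at E4
  simp only [map_neg] at E1 E2 E3 E4
  have c1 := fun p => pderiv_cm j i p
  have c2 := fun p => pderiv_cm k i p
  have c3 := fun p => pderiv_cm l i p
  have c4 := fun p => pderiv_cm k j p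
  have c5 := fun p => pderiv_cm l j p
  have c6 := fun p => pderiv_cm l k p
  simp only [c1, c2, c3, c4, c5, c6] at E1 E2 E3 E4
  have a3 : ∀ i j k, α k i j = α i j k := fun i j k => by rw [hα1 i k j, hα2 i j k, neg_neg]
  have d1 := db i k l
  have d2 := db i j l
  have d3 := db i j k
  have d4 := db j k l
  have d5 := db j i l
  have d6 := db j i k
  have d7 := db k j l
  have d8 := db k i l
  have d9 := db k i j
  have d10 := db l j k
  have d11 := db l i k
  have d12 := db l i j
  rw [hα1 i j l] at d5
  rw [hα1 i j k] at d6
  rw [hα1 j k l] at d7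
  rw [hα1 i k l] at d8
  rw [a3] at d9 d10 d11 d12
  have h6 : (6 : R5) ≠ 0 := OfNat.ofNat_ne_zero 6
  apply mul_left_cancel₀ h6
  linear_combination 3 * (E1 - E2 + E3 - E4) + pderiv j f * d1 - pderiv k f * d2 + pderiv l f * d3
    - (pderiv i f * d4 - pderiv k f * d5 + pderiv l f * d6)
    + (pderiv i f * d7 - pderiv j f * d8 + pderiv l f * d9)
    - (pderiv i f * d10 - pderiv j f * d11 + pderiv k f * d12)

/-- Step 3. -/
lemma alpha_zero (f : R5) (hf : f.IsHomogeneous 3)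
    (hsm : ∀ a : Fin 5 → ℂ, a ≠ 0 → ∃ i, eval a (pderiv i f) ≠ 0)
    (D : Fin 5 → Fin 5 → R5) (hD : ∀ i j, D j i = - D i j) (hD0 : ∀ i, D i i = 0)
    (hD1 : ∀ i j, (D i j).IsHomogeneous 1)
    (α : Fin 5 → Fin 5 → Fin 5 → R5)
    (hα : ∀ i j k, (α i j k).IsHomogeneous 0)
    (h : ∀ i j k l, Q D i j k l =
      pderiv i f * α j k l - pderiv j f * α i k l + pderiv k f * α i j l - pderiv l f * α i j k)
    (a b c d e : Fin 5) (hae : e ≠ a) (hbe : e ≠ b) (hce : e ≠ c) (hde : e ≠ d)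
    (hab : a ≠ b) (hac : a ≠ c) (had : a ≠ d) : α b c d = 0 := by
  have hh : ∀ i j x y z, (D i j * α x y z).IsHomogeneous 1 := fun i j x y z =>
    (hD1 i j).mul (hα x y z)
  have row : ∀ m, Q D b c d e * D m a - Q D a c d e * D m b + Q D a b d e * D m c
      - Q D a b c e * D m d + Q D a b c d * D m e = 0 →
      D m a * α b c d - D m b * α a c d + D m c * α a b d - D m d * α a b c = 0 := by
    intro m hm
    simp only [h] at hm
    refine syz5 f hf hsm a b c d e hae hbe hce hde
      (D m b * α c d e - D m c * α b d e + D m d * α b c e - D m e * α b c d)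
      (- (D m a * α c d e) + D m c * α a d e - D m d * α a c e + D m e * α a c d)
      (D m a * α b d e - D m b * α a d e + D m d * α a b e - D m e * α a b d)
      (- (D m a * α b c e) + D m b * α a c e - D m c * α a b e + D m e * α a b c)
      _ ?_ ?_ ?_ ?_ ?_ ?_
    · exact (((hh _ _ _ _ _).sub (hh _ _ _ _ _)).add (hh _ _ _ _ _)).sub (hh _ _ _ _ _)
    · exact (((hh _ _ _ _ _).neg.add (hh _ _ _ _ _)).sub (hh _ _ _ _ _)).add (hh _ _ _ _ _)
    · exact (((hh _ _ _ _ _).sub (hh _ _ _ _ _)).add (hh _ _ _ _ _)).sub (hh _ _ _ _ _)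
    · exact (((hh _ _ _ _ _).neg.add (hh _ _ _ _ _)).sub (hh _ _ _ _ _)).add (hh _ _ _ _ _)
    · exact (((hh _ _ _ _ _).sub (hh _ _ _ _ _)).add (hh _ _ _ _ _)).sub (hh _ _ _ _ _)
    · linear_combination - hm
  have r2 := row b (by simp only [Q]; rw [hD0, hD a b]; ring)
  have r3 := row c (by simp only [Q]; rw [hD0, hD a c, hD b c]; ring)
  have r4 := row d (by simp only [Q]; rw [hD0, hD a d, hD b d, hD c d]; ring)
  rw [hD0, hD a b] at r2
  rw [hD0, hD a c, hD b c] at r3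
  rw [hD0, hD a d, hD b d, hD c d] at r4
  have hprod : Q D a b c d * α b c d = 0 := by
    simp only [Q]
    linear_combination - D c d * r2 + D b d * r3 - D b c * r4
  rcases mul_eq_zero.mp hprod with h0 | h0
  · rw [h] at h0
    have hX : ∀ x y z, (X 0 * α x y z : R5).IsHomogeneous 1 := fun x y z =>
      (isHomogeneous_X _ 0).mul (hα x y z)
    have := syz5 f hf hsm b b c d a hab hab hac had 0 (- (X 0 * α a c d)) (X 0 * α a b d)
      (- (X 0 * α a b c)) (X 0 * α b c d) (isHomogeneous_zero _ _ _) (hX _ _ _).neg (hX _ _ _)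
      (hX _ _ _).neg (hX _ _ _) (by linear_combination X 0 * h0)
    exact (mul_eq_zero.mp this).resolve_left (X_ne_zero 0)
  · exact h0

lemma main (f : MvPolynomial (Fin 5) ℂ)
    (hf : f.IsHomogeneous 3)
    (hsm : ∀ a : Fin 5 → ℂ, a ≠ 0 → ∃ i, eval a (pderiv i f) ≠ 0)
    (A : Fin 5 → MvPolynomial (Fin 5) ℂ)
    (hA : ∀ i, (A i).IsHomogeneous 2)
    (hrad : ∑ i, X i * A i = 0)
    (a : Fin 5 → Fin 5 → Fin 5 → MvPolynomial (Fin 5) ℂ)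
    (b : Fin 5 → Fin 5 → MvPolynomial (Fin 5) ℂ)
    (ha1 : ∀ i j k, a j i k = - a i j k) (ha2 : ∀ i j k, a i k j = - a i j k)
    (hb : ∀ i j, b j i = - b i j)
    (h : ∀ i j k : Fin 5,
        A i * (pderiv j (A k) - pderiv k (A j))
          + A j * (pderiv k (A i) - pderiv i (A k))
          + A k * (pderiv i (A j) - pderiv j (A i))
        = f * a i j k
          + (pderiv i f * b j k + pderiv j f * b k i + pderiv k f * b i j)) :
    ∀ i j k : Fin 5,
      A i * (pderiv j (A k) - pderiv k (A j))
        + A j * (pderiv k (A i) - pderiv i (A k))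
        + A k * (pderiv i (A j) - pderiv j (A i)) = 0 := by
  let α : Fin 5 → Fin 5 → Fin 5 → R5 := fun i j k => homogeneousComponent 0 (a i j k)
  let β : Fin 5 → Fin 5 → R5 := fun i j => homogeneousComponent 1 (b i j)
  have hα : ∀ i j k, (α i j k).IsHomogeneous 0 := fun i j k => homogeneousComponent_isHomogeneous _ _
  have hβ : ∀ i j, (β i j).IsHomogeneous 1 := fun i j => homogeneousComponent_isHomogeneous _ _
  have hα1 : ∀ i j k, α j i k = - α i j k := fun i j k => by simp only [α]; rw [ha1, map_neg]
  have hα2 : ∀ i j k, α i k j = - α i j k := fun i j k => by simp only [α]; rw [ha2, map_neg]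
  have hβs : ∀ i j, β j i = - β i j := fun i j => by simp only [β]; rw [hb, map_neg]
  have hD1 : ∀ i j, (pderiv i (A j) - pderiv j (A i)).IsHomogeneous 1 := fun i j =>
    (hA j).pderiv.sub (hA i).pderiv
  have h' : ∀ i j k : Fin 5,
        A i * (pderiv j (A k) - pderiv k (A j))
          + A j * (pderiv k (A i) - pderiv i (A k))
          + A k * (pderiv i (A j) - pderiv j (A i))
        = f * α i j k
          + (pderiv i f * β j k + pderiv j f * β k i + pderiv k f * β i j) := by
    intro i j k
    have hom := (((hA i).mul (hD1 j k)).add ((hA j).mul (hD1 k i))).add ((hA k).mul (hD1 i j))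
    rw [← homogeneousComponent_eq_self hom, h i j k, map_add, map_add, map_add]
    have hfd : ∀ i, (pderiv i f).IsHomogeneous 2 := fun i => hf.pderiv
    rw [hc_mul _ _ 2 1 (hfd i), hc_mul _ _ 2 1 (hfd j), hc_mul _ _ 2 1 (hfd k)]
    have := hc_mul f (a i j k) 3 0 hf
    rw [← this]
  have hbeta := beta_eq f hf hsm A hA hrad α β hα hβ hα2 hβs h'
  have hpf := pf_eq f A α β hα hα1 hα2 hβs hbeta h'
  have hz : ∀ i j k, α i j k = 0 := by
    intro i j k
    obtain ⟨x, y, h1, h2, h3, h4, h5, h6, h7⟩ := pick3 i j k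
    exact alpha_zero f hf hsm _ (fun i j => by ring) (fun i => by ring) hD1 α hα hpf x i j k y
      h7.symm h4 h5 h6 h1 h2 h3
  have hβz : ∀ i j, β i j = 0 := by
    intro i j
    have := hbeta i j
    simp only [hz, mul_zero, Finset.sum_const_zero, zero_add] at this
    exact (mul_eq_zero.mp this).resolve_left (OfNat.ofNat_ne_zero 3)
  intro i j k
  rw [h']
  simp [hz, hβz]

end CubicAux

/-- algebraic content of Theorem 5.4.  Let `f ∈ ℂ[x₀,…,x₄]` be homogeneous
of degree 3 whose partial derivatives have no common zero other than the origin (so the cubic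
threefold `X = V(f) ⊂ ℙ⁴` is smooth).  Let `ω = Σᵢ Aᵢ dxᵢ` be a polynomial 1-form with
homogeneous degree-2 coefficients and `ι_𝓡 ω = 0`.  If the 3-form `ω ∧ dω` vanishes on the
cone over `X`, i.e. `ω ∧ dω = f·α + df ∧ β` for some polynomial 3-form `α` and 2-form `β`
(expressed below through the alternating coefficient functions `a` of `α` and `b` of `β`,
with `D_{jk} = ∂_j A_k − ∂_k A_j` so that `(ω∧dω)_{ijk} = Aᵢ D_{jk} + A_j D_{ki} + A_k D_{ij}`
and `(df∧β)_{ijk} = f_{xᵢ} b_{jk} + f_{x_j} b_{ki} + f_{x_k} b_{ij}`), then `ω ∧ dω = 0`. -/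
theorem degree_one_foliation_on_cubic_extends (f : MvPolynomial (Fin 5) ℂ)
    (hf : f.IsHomogeneous 3)
    (hsm : ∀ a : Fin 5 → ℂ, a ≠ 0 → ∃ i, eval a (pderiv i f) ≠ 0)
    (A : Fin 5 → MvPolynomial (Fin 5) ℂ)
    (hA : ∀ i, (A i).IsHomogeneous 2)
    (hrad : ∑ i, X i * A i = 0)
    (hvanish : ∃ (a : Fin 5 → Fin 5 → Fin 5 → MvPolynomial (Fin 5) ℂ)
        (b : Fin 5 → Fin 5 → MvPolynomial (Fin 5) ℂ),
      (∀ i j k, a j i k = - a i j k) ∧ (∀ i j k, a i k j = - a i j k) ∧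
      (∀ i j, b j i = - b i j) ∧
      (∀ i j k : Fin 5,
        A i * (pderiv j (A k) - pderiv k (A j))
          + A j * (pderiv k (A i) - pderiv i (A k))
          + A k * (pderiv i (A j) - pderiv j (A i))
        = f * a i j k
          + (pderiv i f * b j k + pderiv j f * b k i + pderiv k f * b i j))) :
    ∀ i j k : Fin 5,
      A i * (pderiv j (A k) - pderiv k (A j))
        + A j * (pderiv k (A i) - pderiv i (A k))
        + A k * (pderiv i (A j) - pderiv j (A i)) = 0 := by
  obtain ⟨a, b, h1, h2, h3, h4⟩ := hvanish
  exact CubicAux.main f hf hsm A hA hrad a b h1 h2 h3 h4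
end

section
/- Let f ∈ ℂ[x₀,…,x₄] be homogeneous of degree 3 whose partial derivatives have no common zero in ℂ⁵ other than the origin, and set v₂ = (∂f/∂x₁) ∂/∂x₀ − (∂f/∂x₀) ∂/∂x₁. Let ω be a polynomial 1-form on ℂ⁵ whose coefficients are homogeneous of degree 2 and which satisfies ι_𝓡 ω = 0. If ι_{v₂} ω = 0 and ι_{v₂}(dω) = 0, then ω ∧ dω = 0. -/
open MvPolynomial

noncomputable def chainP (k : ℕ) : Ideal (MvPolynomial (Fin 5) ℂ) :=
  RingHom.ker (aeval (fun i : Fin 5 => if i.1 < k then (0 : MvPolynomial (Fin 5) ℂ) else X i))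

instance (k : ℕ) : (chainP k).IsPrime := RingHom.ker_isPrime _

lemma chainP_lt (k : ℕ) (hk : k < 5) : chainP k < chainP (k + 1) := by
  refine lt_of_le_of_ne ?_ ?_
  · intro p hp
    simp only [chainP, RingHom.mem_ker] at hp ⊢
    have h2 := congrArg
      (aeval (fun i : Fin 5 => if i.1 < k + 1 then (0 : MvPolynomial (Fin 5) ℂ) else X i)) hp
    rw [map_zero, ← AlgHom.comp_apply, comp_aeval] at h2
    refine Eq.trans ?_ h2
    congr 2
    funext i
    by_cases h : i.1 < k
    · simp [h, Nat.lt_succ_of_lt h]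
    · simp [h]
  · intro h
    have h1 : (X ⟨k, hk⟩ : MvPolynomial (Fin 5) ℂ) ∈ chainP (k + 1) := by
      simp [chainP, RingHom.mem_ker]
    rw [← h] at h1
    simp [chainP, RingHom.mem_ker] at h1

lemma chainP_height (k : ℕ) (hk : k ≤ 5) : (k : ℕ∞) ≤ (chainP k).height := by
  induction k with
  | zero => simp
  | succ n ih =>
    have := Ideal.height_add_one_le_of_lt_of_isPrime (chainP_lt n (by omega))
    push_cast
    exact le_trans (by gcongr; exact ih (by omega)) this

lemma chainP_five (p : MvPolynomial (Fin 5) ℂ) : p ∈ chainP 5 ↔ eval 0 p = 0 := by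
  have : (fun i : Fin 5 => if i.1 < 5 then (0 : MvPolynomial (Fin 5) ℂ) else X i) = 0 := by
    funext i; simp
  rw [chainP, RingHom.mem_ker, this, aeval_zero]
  simp [MvPolynomial.eval_zero]

lemma exists_zero (s : Finset (MvPolynomial (Fin 5) ℂ)) (hs : s.card ≤ 4)
    (h0 : ∀ g ∈ s, eval 0 g = 0) : ∃ a : Fin 5 → ℂ, a ≠ 0 ∧ ∀ g ∈ s, eval a g = 0 := by
  by_contra! hcon
  have hmin : chainP 5 ∈ (Ideal.span (s : Set (MvPolynomial (Fin 5) ℂ))).minimalPrimes := by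
    refine ⟨⟨inferInstance, ?_⟩, ?_⟩
    · rw [Ideal.span_le]
      intro g hg
      exact (chainP_five g).2 (h0 g hg)
    · rintro P ⟨hP, hJ⟩ hle
      have hv := MvPolynomial.IsPrime.vanishingIdeal_zeroLocus (K := ℂ) P
      intro p hp
      rw [← hv, mem_vanishingIdeal_iff]
      intro x hx
      rw [mem_zeroLocus_iff] at hx
      by_cases hx0 : x = 0
      · subst hx0
        simpa [aeval_eq_eval] using (chainP_five p).1 hp
      · obtain ⟨g, hg, hne⟩ := hcon x hx0
        exact absurd (by simpa [aeval_eq_eval] using hx g (hJ (Ideal.subset_span hg))) hne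
  have h1 := Ideal.height_le_card_of_mem_minimalPrimes_span_finset hmin
  have h2 := chainP_height 5 le_rfl
  have h3 : ((5 : ℕ) : ℕ∞) ≤ ((4 : ℕ) : ℕ∞) := h2.trans (h1.trans (by exact_mod_cast hs))
  exact absurd (by exact_mod_cast h3) (by norm_num : ¬ (5 ≤ 4))

lemma homog_eval_zero {p : MvPolynomial (Fin 5) ℂ} {n : ℕ} (hp : p.IsHomogeneous n)
    (hn : n ≠ 0) : eval 0 p = 0 := by
  rw [MvPolynomial.eval_zero, constantCoeff_eq]
  exact hp.coeff_eq_zero (by simpa using hn.symm)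

lemma no_common (f : MvPolynomial (Fin 5) ℂ) (hf : f.IsHomogeneous 3)
    (hsm : ∀ a : Fin 5 → ℂ, a ≠ 0 → ∃ i, eval a (pderiv i f) ≠ 0)
    (h : MvPolynomial (Fin 5) ℂ) (h0 : eval 0 h = 0) (hp : h ∣ pderiv 0 f)
    (hq : h ∣ pderiv 1 f) : False := by
  classical
  obtain ⟨a, ha, hz⟩ := exists_zero {h, pderiv 2 f, pderiv 3 f, pderiv 4 f}
    Finset.card_le_four (by
      have hh : ∀ i, eval 0 (pderiv i f) = 0 := fun i => homog_eval_zero (hf.pderiv (i := i))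
        (by norm_num)
      simp only [Finset.mem_insert, Finset.mem_singleton, forall_eq_or_imp, forall_eq]
      exact ⟨h0, hh 2, hh 3, hh 4⟩)
  simp only [Finset.mem_insert, Finset.mem_singleton, forall_eq_or_imp, forall_eq] at hz
  obtain ⟨i, hi⟩ := hsm a ha
  obtain ⟨p', hp⟩ := hp
  obtain ⟨q', hq⟩ := hq
  apply hi
  fin_cases i
  · simp [hp, hz.1]
  · simp [hq, hz.1]
  · exact hz.2.1
  · exact hz.2.2.1
  · exact hz.2.2.2

lemma lin_zero (p q a b : MvPolynomial (Fin 5) ℂ) (hp : p.IsHomogeneous 2)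
    (hq : q.IsHomogeneous 2) (ha : a.IsHomogeneous 1) (hb : b.IsHomogeneous 1)
    (hk : ∀ h : MvPolynomial (Fin 5) ℂ, eval 0 h = 0 → h ∣ p → h ∣ q → False)
    (h : q * a = p * b) : a = 0 ∧ b = 0 := by
  have hp0 : p ≠ 0 := by
    rintro rfl
    exact hk q (homog_eval_zero hq two_ne_zero) (dvd_zero _) dvd_rfl
  have hq0 : q ≠ 0 := by
    rintro rfl
    exact hk p (homog_eval_zero hp two_ne_zero) dvd_rfl (dvd_zero _)
  by_cases ha0 : a = 0
  · subst ha0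
    simp_all
  exfalso
  have hir : Irreducible a := by
    refine irreducible_of_totalDegree_eq_one (ha.totalDegree ha0) ?_
    intro x hx
    obtain ⟨m, hm⟩ := ne_zero_iff.1 ha0
    have := hx m
    exact (isUnit_iff_ne_zero.2 (by rintro rfl; simp_all))
  have hpr : Prime a := hir.prime
  rcases hpr.dvd_or_dvd (⟨q, by rw [← h]; ring⟩ : a ∣ p * b) with ⟨p', hp'⟩ | ⟨c, hc⟩
  · refine hk p' ?_ ⟨a, by rw [hp']; ring⟩ ⟨b, ?_⟩
    · have hE := ha.sum_X_mul_pderiv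
      obtain ⟨i, hi⟩ : ∃ i, pderiv i a ≠ 0 := by
        by_contra! hcon
        simp [hcon] at hE
        exact ha0 hE.symm
      have hc := ha.pderiv (i := i)
      rw [← totalDegree_zero_iff_isHomogeneous, totalDegree_eq_zero_iff_eq_C] at hc
      have h1 := homog_eval_zero (hp.pderiv (i := i)) (by norm_num)
      rw [hp', pderiv_mul] at h1
      rw [hc] at h1 hi
      simp only [map_add, map_mul, eval_C, homog_eval_zero ha one_ne_zero, zero_mul, add_zero,
        mul_eq_zero] at h1
      rcases h1 with h1 | h1
      · exact absurd (by rw [h1, C_0]) hi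
      · exact h1
    · apply mul_left_cancel₀ ha0
      rw [mul_comm a q, h, hp']; ring
  · refine hk p (homog_eval_zero hp two_ne_zero) dvd_rfl ⟨c, ?_⟩
    apply mul_left_cancel₀ ha0
    rw [mul_comm a q, h, hc]; ring


open MvPolynomial

/-- Case 2 in the proof of Theorem 5.4.  Let `f ∈ ℂ[x₀,…,x₄]` be
homogeneous of degree 3 whose partial derivatives have no common zero other than the origin,
and let `v₂ = f_{x₁}∂₀ − f_{x₀}∂₁`.  Let `ω = Σᵢ Aᵢ dxᵢ` be a polynomial 1-form with
homogeneous degree-2 coefficients and `ι_𝓡 ω = 0`.  If `ι_{v₂} ω = 0` and `ι_{v₂}(dω) = 0`,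
then `ω ∧ dω = 0`; in coefficients, with `D_{jk} = ∂_j A_k − ∂_k A_j`, the alternating
3-form with coefficients `Aᵢ D_{jk} + A_j D_{ki} + A_k D_{ij}` vanishes. -/
theorem case2_contraction_v2_gives_integrability (f : MvPolynomial (Fin 5) ℂ)
    (hf : f.IsHomogeneous 3)
    (hsm : ∀ a : Fin 5 → ℂ, a ≠ 0 → ∃ i, eval a (pderiv i f) ≠ 0)
    (A : Fin 5 → MvPolynomial (Fin 5) ℂ)
    (hA : ∀ i, (A i).IsHomogeneous 2)
    (hrad : ∑ i, X i * A i = 0)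
    (hiv : ∑ i, (![pderiv 1 f, -(pderiv 0 f), 0, 0, 0] : Fin 5 → _) i * A i = 0)
    (hivd : ∀ j : Fin 5,
      ∑ i, (![pderiv 1 f, -(pderiv 0 f), 0, 0, 0] : Fin 5 → _) i
        * (pderiv i (A j) - pderiv j (A i)) = 0) :
    ∀ i j k : Fin 5,
      A i * (pderiv j (A k) - pderiv k (A j))
        + A j * (pderiv k (A i) - pderiv i (A k))
        + A k * (pderiv i (A j) - pderiv j (A i)) = 0 := by
  have hD : ∀ j k, (pderiv j (A k) - pderiv k (A j)).IsHomogeneous 1 := fun j k =>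
    ((hA k).pderiv (i := j)).sub ((hA j).pderiv (i := k))
  have h01 : ∀ j, pderiv 0 (A j) - pderiv j (A 0) = 0 ∧ pderiv 1 (A j) - pderiv j (A 1) = 0 := by
    intro j
    refine lin_zero (pderiv 0 f) (pderiv 1 f) _ _ hf.pderiv hf.pderiv (hD 0 j) (hD 1 j)
      (no_common f hf hsm) ?_
    have := hivd j
    simp [Fin.sum_univ_five] at this
    linear_combination this
  have hcontr : ∀ j, 3 * A j = ∑ i, X i * (pderiv i (A j) - pderiv j (A i)) := by
    intro j
    have h1 := (hA j).sum_X_mul_pderiv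
    have h2 := congrArg (pderiv j) hrad
    simp only [map_sum, pderiv_mul, map_zero, Finset.sum_add_distrib, pderiv_X] at h2
    have h3 : ∑ x, (Pi.single j 1 : Fin 5 → MvPolynomial (Fin 5) ℂ) x * A x = A j := by
      simp [Pi.single_apply]
    have h4 : ∑ x, (Pi.single x 1 : Fin 5 → MvPolynomial (Fin 5) ℂ) j * A x = A j := by
      simp [Pi.single_apply]
    simp only [mul_sub, Finset.sum_sub_distrib, h1]
    first
    | rw [h3] at h2; rw [nsmul_eq_mul]; push_cast; linear_combination h2
    | rw [h4] at h2; rw [nsmul_eq_mul]; push_cast; linear_combination h2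
  have h3 : (3 : MvPolynomial (Fin 5) ℂ) ≠ 0 := by norm_num
  generalize hDD : (fun j k => pderiv j (A k) - pderiv k (A j)) = D at *
  have hDe : ∀ j k, pderiv j (A k) - pderiv k (A j) = D j k := fun j k => by rw [← hDD]
  simp only [hDe] at h01 hcontr ⊢
  have hanti : ∀ j k, D j k = - D k j := fun j k => by rw [← hDe, ← hDe]; ring
  have hdiag : ∀ j, D j j = 0 := fun j => by rw [← hDe]; ring
  have h0 : ∀ j, D 0 j = 0 := fun j => (h01 j).1
  have h1 : ∀ j, D 1 j = 0 := fun j => (h01 j).2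
  have h0' : ∀ j, D j 0 = 0 := fun j => by rw [hanti, h0, neg_zero]
  have h1' : ∀ j, D j 1 = 0 := fun j => by rw [hanti, h1, neg_zero]
  have e32 := hanti 3 2
  have e42 := hanti 4 2
  have e43 := hanti 4 3
  have a0 : A 0 = 0 := by simpa [h0', h3] using hcontr 0
  have a1 : A 1 = 0 := by simpa [h1', h3] using hcontr 1
  have a2 := hcontr 2
  have a3 := hcontr 3
  have a4 := hcontr 4
  simp only [Fin.sum_univ_five, h0, h1, hdiag, e32, e42, e43] at a2 a3 a4
  have key : A 2 * D 3 4 - A 3 * D 2 4 + A 4 * D 2 3 = 0 := by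
    apply mul_left_cancel₀ h3
    linear_combination D 3 4 * a2 - D 2 4 * a3 + D 2 3 * a4
  intro i j k
  fin_cases i <;> fin_cases j <;> fin_cases k <;>
    simp only [Fin.zero_eta, Fin.mk_one, Fin.reduceFinMk, h0, h1, h0', h1', hdiag, e32, e42, e43,
      a0, a1, mul_zero, zero_mul, add_zero] <;>
    first
    | ring1
    | linear_combination key
    | linear_combination -key
end

section
/- Let f ∈ ℂ[x₀,…,x₄] be homogeneous of degree 3 whose partial derivatives have no common zero in ℂ⁵ other than the origin. Let η be a polynomial 3-form on ℂ⁵ such that ι_𝓡 η = 0 and such that η vanishes on the cone over V(f), i.e., η = f·α + df ∧ β for some polynomial 3-form α and polynomial 2-form β. Then there exists a polynomial vector field v on ℂ⁵ with v(f) = 0 such that η = ι_𝓡 ι_v (dx₀ ∧ dx₁ ∧ dx₂ ∧ dx₃ ∧ dx₄). -/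
open MvPolynomial

noncomputable def Tdeg (n : ℕ) : MvPolynomial (Fin 5) ℂ →ₗ[ℂ] MvPolynomial (Fin 5) ℂ :=
  (basisMonomials (Fin 5) ℂ).constr ℂ fun s => monomial s (((s.degree + n : ℕ) : ℂ)⁻¹)

lemma Tdeg_monomial (n : ℕ) (s : Fin 5 →₀ ℕ) (c : ℂ) :
    Tdeg n (monomial s c) = monomial s (c * ((s.degree + n : ℕ) : ℂ)⁻¹) := by
  have h : monomial s c = c • (basisMonomials (Fin 5) ℂ s) := by
    simp [smul_monomial]
  rw [h, map_smul, Tdeg, Module.Basis.constr_basis, smul_monomial, smul_eq_mul]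

lemma Tdeg_X_mul (n : ℕ) (i : Fin 5) (p : MvPolynomial (Fin 5) ℂ) :
    Tdeg n (X i * p) = X i * Tdeg (n + 1) p := by
  induction p using MvPolynomial.induction_on' with
  | monomial s c =>
    rw [Tdeg_monomial, X, monomial_mul, monomial_mul, Tdeg_monomial]
    simp only [map_add, Finsupp.degree_single, one_mul]
    congr 4
    ring
  | add p q hp hq => rw [mul_add, map_add, map_add, mul_add, hp, hq]

lemma Tdeg_euler (n : ℕ) (hn : n ≠ 0) (p : MvPolynomial (Fin 5) ℂ) :
    Tdeg n (∑ i, X i * pderiv i p + n * p) = p := by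
  induction p using MvPolynomial.induction_on' with
  | monomial s c =>
    have h : (∑ i, X i * pderiv i (monomial s c) + n * (monomial s c : MvPolynomial (Fin 5) ℂ))
        = (((s.degree + n : ℕ) : ℂ)) • monomial s c := by
      simp only [X_mul_pderiv_monomial]
      rw [← Finset.sum_smul, ← nsmul_eq_mul, ← add_smul, Finsupp.degree_eq_sum,
        Nat.cast_smul_eq_nsmul]
    rw [h, map_smul, Tdeg_monomial, smul_monomial, smul_eq_mul]
    congr 1
    have : ((s.degree + n : ℕ) : ℂ) ≠ 0 := by
      exact_mod_cast (by omega : s.degree + n ≠ 0)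
    field_simp
  | add p q hp hq =>
    have : ∑ i, X i * pderiv i (p + q) + n * (p + q)
      = (∑ i, X i * pderiv i p + n * p) + (∑ i, X i * pderiv i q + n * q) := by
      simp only [map_add, mul_add, Finset.sum_add_distrib]; ring
    rw [this, map_add, hp, hq]

noncomputable def gam (e : Fin 5 → Fin 5 → Fin 5 → MvPolynomial (Fin 5) ℂ) (i j k l : Fin 5) :
    MvPolynomial (Fin 5) ℂ :=
  Tdeg 4 (pderiv i (e j k l) - pderiv j (e i k l) + pderiv k (e i j l) - pderiv l (e i j k))

lemma gam_homotopy (e : Fin 5 → Fin 5 → Fin 5 → MvPolynomial (Fin 5) ℂ)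
    (he1 : ∀ i j k, e j i k = - e i j k) (he2 : ∀ i j k, e i k j = - e i j k)
    (hrad : ∀ j k : Fin 5, ∑ i, X i * e i j k = 0) (j k l : Fin 5) :
    ∑ i, X i * gam e i j k l = e j k l := by
  have key : ∀ m j k : Fin 5, ∑ i, X i * pderiv m (e i j k) = - e m j k := by
    intro m j k
    have h := congrArg (pderiv m) (hrad j k)
    rw [map_sum, map_zero] at h
    simp only [Derivation.leibniz, smul_eq_mul, pderiv_X, Finset.sum_add_distrib] at h
    have h2 : ∑ i, e i j k * (Pi.single m 1 : Fin 5 → MvPolynomial (Fin 5) ℂ) i = e m j k := by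
      simp [Pi.single_apply]
    rw [h2] at h; linear_combination h
  simp only [gam]
  simp only [← Tdeg_X_mul 3]
  rw [← map_sum]
  conv_rhs => rw [← Tdeg_euler 3 (by norm_num) (e j k l)]
  congr 1
  simp only [mul_add, mul_sub, Finset.sum_add_distrib, Finset.sum_sub_distrib]
  rw [key j k l, key k j l, key l j k]
  have := he1 j k l
  have h2 := he1 j l k
  have h3 := he2 j k l
  push_cast
  linear_combination -this + h2 - h3

lemma alt_zero (h : Fin 5 → Fin 5 → Fin 5 → MvPolynomial (Fin 5) ℂ)
    (h1 : ∀ i j k, h j i k = - h i j k) (h2 : ∀ i j k, h i k j = - h i j k)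
    (h0 : ∀ i j k, i < j → j < k → h i j k = 0) (i j k : Fin 5) : h i j k = 0 := by
  have d1 : ∀ i k, h i i k = 0 := fun i k => self_eq_neg.mp (h1 i i k)
  have d2 : ∀ i k, h i k k = 0 := fun i k => self_eq_neg.mp (h2 i k k)
  have A : ∀ i j k, i < j → h i j k = 0 := by
    intro i j k hij
    rcases lt_trichotomy j k with a | a | a
    · exact h0 _ _ _ hij a
    · subst a; exact d2 _ _
    · rw [h2 i k j, neg_eq_zero]
      rcases lt_trichotomy i k with b | b | b
      · exact h0 _ _ _ b a
      · subst b; exact d1 _ _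
      · rw [h1 k i j, h0 _ _ _ b hij, neg_zero]
  rcases lt_trichotomy i j with a | a | a
  · exact A _ _ _ a
  · subst a; exact d1 _ _
  · rw [h1 j i k, A _ _ _ a, neg_zero]

noncomputable def Dd (v : Fin 5 → MvPolynomial (Fin 5) ℂ) (a b c : Fin 5) : MvPolynomial (Fin 5) ℂ :=
  Matrix.det (Matrix.of
          ![v, fun i => X i,
            Pi.single a (1 : MvPolynomial (Fin 5) ℂ),
            Pi.single b (1 : MvPolynomial (Fin 5) ℂ),
            Pi.single c (1 : MvPolynomial (Fin 5) ℂ)])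

lemma det_swap23 {A : Type*} [CommRing A] (p q a b c : Fin 5 → A) :
    Matrix.det (Matrix.of ![p, q, b, a, c]) = - Matrix.det (Matrix.of ![p, q, a, b, c]) := by
  have h := Matrix.det_permute (Equiv.swap (2 : Fin 5) 3) (Matrix.of ![p, q, a, b, c])
  rw [Equiv.Perm.sign_swap (by decide)] at h
  have h2 : (Matrix.of ![p, q, a, b, c]).submatrix (Equiv.swap (2 : Fin 5) 3) id
      = Matrix.of ![p, q, b, a, c] := by
    ext i j
    fin_cases i <;> rfl
  rw [h2] at h
  rw [h]; simp

lemma det_swap34 {A : Type*} [CommRing A] (p q a b c : Fin 5 → A) :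
    Matrix.det (Matrix.of ![p, q, a, c, b]) = - Matrix.det (Matrix.of ![p, q, a, b, c]) := by
  have h := Matrix.det_permute (Equiv.swap (3 : Fin 5) 4) (Matrix.of ![p, q, a, b, c])
  rw [Equiv.Perm.sign_swap (by decide)] at h
  have h2 : (Matrix.of ![p, q, a, b, c]).submatrix (Equiv.swap (3 : Fin 5) 4) id
      = Matrix.of ![p, q, a, c, b] := by
    ext i j
    fin_cases i <;> rfl
  rw [h2] at h
  rw [h]; simp

lemma Dd_alt1 (v : Fin 5 → MvPolynomial (Fin 5) ℂ) (a b c : Fin 5) :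
    Dd v b a c = - Dd v a b c := det_swap23 _ _ _ _ _

lemma Dd_alt2 (v : Fin 5 → MvPolynomial (Fin 5) ℂ) (a b c : Fin 5) :
    Dd v a c b = - Dd v a b c := det_swap34 _ _ _ _ _

noncomputable def Dg {A : Type*} [CommRing A] (v x : Fin 5 → A) (a b c : Fin 5) : A :=
  Matrix.det (Matrix.of
    ![v, x, Pi.single a (1 : A), Pi.single b (1 : A), Pi.single c (1 : A)])

set_option maxRecDepth 10000 in
set_option maxHeartbeats 2000000 in
lemma Dg_vals {A : Type*} [CommRing A] (v x : Fin 5 → A) :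
    Dg v x 2 3 4 = v 0 * x 1 - v 1 * x 0 ∧
    Dg v x 1 3 4 = v 2 * x 0 - v 0 * x 2 ∧
    Dg v x 1 2 4 = v 0 * x 3 - v 3 * x 0 ∧
    Dg v x 1 2 3 = v 4 * x 0 - v 0 * x 4 ∧
    Dg v x 0 3 4 = v 1 * x 2 - v 2 * x 1 ∧
    Dg v x 0 2 4 = v 3 * x 1 - v 1 * x 3 ∧
    Dg v x 0 2 3 = v 1 * x 4 - v 4 * x 1 ∧
    Dg v x 0 1 4 = v 2 * x 3 - v 3 * x 2 ∧
    Dg v x 0 1 3 = v 4 * x 2 - v 2 * x 4 ∧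
    Dg v x 0 1 2 = v 3 * x 4 - v 4 * x 3 := by
  have s0 : (Pi.single 0 1 : Fin 5 → A) = ![1, 0, 0, 0, 0] := by
    ext i; fin_cases i <;> rfl
  have s1 : (Pi.single 1 1 : Fin 5 → A) = ![0, 1, 0, 0, 0] := by
    ext i; fin_cases i <;> rfl
  have s2 : (Pi.single 2 1 : Fin 5 → A) = ![0, 0, 1, 0, 0] := by
    ext i; fin_cases i <;> rfl
  have s3 : (Pi.single 3 1 : Fin 5 → A) = ![0, 0, 0, 1, 0] := by
    ext i; fin_cases i <;> rfl
  have s4 : (Pi.single 4 1 : Fin 5 → A) = ![0, 0, 0, 0, 1] := by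
    ext i; fin_cases i <;> rfl
  unfold Dg
  rw [s0, s1, s2, s3, s4]
  clear s0 s1 s2 s3 s4
  refine ⟨?_, ?_, ?_, ?_, ?_, ?_, ?_, ?_, ?_, ?_⟩ <;>
  · simp [Matrix.det_succ_row_zero, Fin.sum_univ_succ, Fin.succAbove]
    try ring

lemma forall_lt_cases {P : Fin 5 → Fin 5 → Fin 5 → Prop}
    (h1 : P 2 3 4) (h2 : P 1 3 4) (h3 : P 1 2 4) (h4 : P 1 2 3) (h5 : P 0 3 4) (h6 : P 0 2 4)
    (h7 : P 0 2 3) (h8 : P 0 1 4) (h9 : P 0 1 3) (h10 : P 0 1 2) :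
    ∀ i j k, i < j → j < k → P i j k := by
  intro i j k hij hjk
  fin_cases i <;> fin_cases j <;> first
    | exact absurd hij (by decide)
    | (fin_cases k <;> first
        | exact absurd hjk (by decide)
        | assumption)

lemma dvd_of_dvd_mul_X (f h : MvPolynomial (Fin 5) ℂ) (h0 : f ∣ h * X 0) (h1 : f ∣ h * X 1) :
    f ∣ h := by
  obtain ⟨a, ha⟩ := h0
  obtain ⟨b, hb⟩ := h1
  have x0 : (X 0 : MvPolynomial (Fin 5) ℂ) ≠ 0 := X_ne_zero 0
  by_cases hf : f = 0
  · subst hf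
    rw [zero_mul] at ha
    rcases mul_eq_zero.mp ha with h | h
    · rw [h]
    · exact absurd h x0
  have hab : a * X 1 = b * X 0 := by
    apply mul_left_cancel₀ hf
    linear_combination (X 0) * hb - (X 1) * ha
  have hp : Prime (X 0 : MvPolynomial (Fin 5) ℂ) := X_prime
  have hd : (X 0 : MvPolynomial (Fin 5) ℂ) ∣ a * X 1 := ⟨b, by rw [hab]; ring⟩
  rcases hp.dvd_or_dvd hd with ⟨c, hc⟩ | h
  · refine ⟨c, mul_right_cancel₀ x0 ?_⟩
    rw [ha, hc]; ring
  · rw [X_dvd_X] at h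
    simp at h

lemma koszul (e : Fin 5 → Fin 5 → Fin 5 → MvPolynomial (Fin 5) ℂ)
    (he1 : ∀ i j k, e j i k = - e i j k) (he2 : ∀ i j k, e i k j = - e i j k)
    (hrad : ∀ j k : Fin 5, ∑ i, X i * e i j k = 0) :
    ∃ w : Fin 5 → MvPolynomial (Fin 5) ℂ, ∀ i j k, i < j → j < k →
      e i j k = Dg w (fun i => X i) i j k := by
  have d1 : ∀ i k, e i i k = 0 := fun i k => self_eq_neg.mp (he1 i i k)
  have d2 : ∀ i k, e i k k = 0 := fun i k => self_eq_neg.mp (he2 i k k)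
  have g1 : ∀ i j k l, gam e j i k l = - gam e i j k l := by
    intro i j k l
    rw [gam, gam, ← map_neg, he1 i j l, he1 i j k]
    congr 1; simp only [map_neg]; ring
  have g2 : ∀ i j k l, gam e i k j l = - gam e i j k l := by
    intro i j k l
    rw [gam, gam, ← map_neg, he1 j k l, he2 i j k]
    congr 1; simp only [map_neg]; ring
  have g3 : ∀ i j k l, gam e i j l k = - gam e i j k l := by
    intro i j k l
    rw [gam, gam, ← map_neg, he2 j k l, he2 i k l]
    congr 1; simp only [map_neg]; ring
  have z1 : ∀ i k l, gam e i i k l = 0 := fun i k l => self_eq_neg.mp (g1 i i k l)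
  have z2 : ∀ i k l, gam e i k i l = 0 := fun i k l => by rw [g2, z1, neg_zero]
  have z3 : ∀ i k l, gam e i k l i = 0 := fun i k l => by rw [g3, z2, neg_zero]
  have H := gam_homotopy e he1 he2 hrad
  have key : ∀ j k l, e j k l = X 0 * gam e 0 j k l + X 1 * gam e 1 j k l + X 2 * gam e 2 j k l
      + X 3 * gam e 3 j k l + X 4 * gam e 4 j k l := by
    intro j k l
    rw [← H j k l, Fin.sum_univ_five]
  refine ⟨![gam e 1 2 3 4, -gam e 0 2 3 4, gam e 0 1 3 4, -gam e 0 1 2 4, gam e 0 1 2 3], ?_⟩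
  obtain ⟨v1, v2, v3, v4, v5, v6, v7, v8, v9, v10⟩ := Dg_vals
    ![gam e 1 2 3 4, -gam e 0 2 3 4, gam e 0 1 3 4, -gam e 0 1 2 4, gam e 0 1 2 3]
    (fun i => (X i : MvPolynomial (Fin 5) ℂ))
  simp only [Matrix.cons_val] at v1 v2 v3 v4 v5 v6 v7 v8 v9 v10
  have c1 : e 2 3 4 = _ := (key 2 3 4).trans (Eq.trans (by simp only [z1, z2, z3]; ring) v1.symm)
  have c2 : e 1 3 4 = _ := (key 1 3 4).trans (Eq.trans (by
    rw [g1 1 2 3 4]; simp only [z1, z2, z3]; ring) v2.symm)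
  have c3 : e 1 2 4 = _ := (key 1 2 4).trans (Eq.trans (by
    rw [g1 1 3 2 4, g2 1 2 3 4]; simp only [z1, z2, z3]; ring) v3.symm)
  have c4 : e 1 2 3 = _ := (key 1 2 3).trans (Eq.trans (by
    rw [g1 1 4 2 3, g2 1 2 4 3, g3 1 2 3 4]; simp only [z1, z2, z3]; ring) v4.symm)
  have c5 : e 0 3 4 = _ := (key 0 3 4).trans (Eq.trans (by
    rw [g1 0 1 3 4, g1 0 2 3 4]; simp only [z1, z2, z3]; ring) v5.symm)
  have c6 : e 0 2 4 = _ := (key 0 2 4).trans (Eq.trans (by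
    rw [g1 0 1 2 4, g1 0 3 2 4, g2 0 2 3 4]; simp only [z1, z2, z3]; ring) v6.symm)
  have c7 : e 0 2 3 = _ := (key 0 2 3).trans (Eq.trans (by
    rw [g1 0 1 2 3, g1 0 4 2 3, g2 0 2 4 3, g3 0 2 3 4]; simp only [z1, z2, z3]; ring) v7.symm)
  have c8 : e 0 1 4 = _ := (key 0 1 4).trans (Eq.trans (by
    rw [g1 0 2 1 4, g2 0 1 2 4, g1 0 3 1 4, g2 0 1 3 4]; simp only [z1, z2, z3]; ring) v8.symm)
  have c9 : e 0 1 3 = _ := (key 0 1 3).trans (Eq.trans (by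
    rw [g1 0 2 1 3, g2 0 1 2 3, g1 0 4 1 3, g2 0 1 4 3, g3 0 1 3 4]
    simp only [z1, z2, z3]; ring) v9.symm)
  have c10 : e 0 1 2 = _ := (key 0 1 2).trans (Eq.trans (by
    rw [g1 0 3 1 2, g2 0 1 3 2, g3 0 1 2 3, g1 0 4 1 2, g2 0 1 4 2, g3 0 1 2 4]
    simp only [z1, z2, z3]; ring) v10.symm)
  exact forall_lt_cases (P := fun i j k => e i j k = Dg _ (fun i => X i) i j k)
    c1 c2 c3 c4 c5 c6 c7 c8 c9 c10

/-- Let `f ∈ ℂ[x₀,…,x₄]` be homogeneous of degree 3 whose partial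
derivatives have no common zero other than the origin.  Let `η` be a polynomial 3-form,
given by its alternating coefficient function `e` (so `η = Σ_{i<j<k} e i j k · dxᵢ∧dx_j∧dx_k`),
with `ι_𝓡 η = 0`, and suppose `η` vanishes on the cone over `V(f)`:
`η = f·α + df∧β` for some polynomial 3-form `α` and 2-form `β`.
Then there is a polynomial vector field `v` with `v(f) = 0` such that
`η = ι_𝓡 ι_v (dx₀∧dx₁∧dx₂∧dx₃∧dx₄)`; in coefficients,
`e a b c = det (rows: v, 𝓡, e_a, e_b, e_c)` for all `a b c`. -/
theorem nonintegrability_tensor_gives_tangent_field (f : MvPolynomial (Fin 5) ℂ)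
    (hf : f.IsHomogeneous 3)
    (hsm : ∀ a : Fin 5 → ℂ, a ≠ 0 → ∃ i, eval a (pderiv i f) ≠ 0)
    (e : Fin 5 → Fin 5 → Fin 5 → MvPolynomial (Fin 5) ℂ)
    (he1 : ∀ i j k, e j i k = - e i j k) (he2 : ∀ i j k, e i k j = - e i j k)
    (hrad : ∀ j k : Fin 5, ∑ i, X i * e i j k = 0)
    (hvanish : ∃ (a : Fin 5 → Fin 5 → Fin 5 → MvPolynomial (Fin 5) ℂ)
        (b : Fin 5 → Fin 5 → MvPolynomial (Fin 5) ℂ),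
      (∀ i j k, a j i k = - a i j k) ∧ (∀ i j k, a i k j = - a i j k) ∧
      (∀ i j, b j i = - b i j) ∧
      (∀ i j k : Fin 5,
        e i j k = f * a i j k
          + (pderiv i f * b j k + pderiv j f * b k i + pderiv k f * b i j))) :
    ∃ v : Fin 5 → MvPolynomial (Fin 5) ℂ,
      (∑ i, v i * pderiv i f = 0) ∧
      ∀ a b c : Fin 5,
        e a b c = Matrix.det (Matrix.of
          ![v, fun i => X i,
            Pi.single a (1 : MvPolynomial (Fin 5) ℂ),
            Pi.single b (1 : MvPolynomial (Fin 5) ℂ),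
            Pi.single c (1 : MvPolynomial (Fin 5) ℂ)]) := by
  obtain ⟨w, hw⟩ := koszul e he1 he2 hrad
  obtain ⟨a, b, ha1, ha2, hb, hab⟩ := hvanish
  have hE : ∑ i, X i * pderiv i f = 3 * f := by
    rw [hf.sum_X_mul_pderiv, nsmul_eq_mul]; norm_num
  rw [Fin.sum_univ_five] at hE
  obtain ⟨v1, v2, v3, v4, v5, v6, v7, v8, v9, v10⟩ :=
    Dg_vals w (fun i => (X i : MvPolynomial (Fin 5) ℂ))
  rw [← hw 2 3 4 (by decide) (by decide)] at v1
  rw [← hw 1 3 4 (by decide) (by decide)] at v2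
  rw [← hw 1 2 4 (by decide) (by decide)] at v3
  rw [← hw 1 2 3 (by decide) (by decide)] at v4
  rw [← hw 0 3 4 (by decide) (by decide)] at v5
  rw [← hw 0 2 4 (by decide) (by decide)] at v6
  rw [← hw 0 2 3 (by decide) (by decide)] at v7
  have hdvd : f ∣ ∑ i, w i * pderiv i f := by
    rw [Fin.sum_univ_five]
    apply dvd_of_dvd_mul_X
    · refine ⟨3 * w 0 - (pderiv 1 f * a 2 3 4 - pderiv 2 f * a 1 3 4 + pderiv 3 f * a 1 2 4
        - pderiv 4 f * a 1 2 3), ?_⟩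
      have b1 := hab 2 3 4
      have b2 := hab 1 3 4
      have b3 := hab 1 2 4
      have b4 := hab 1 2 3
      rw [v1, hb 2 4] at b1
      rw [v2, hb 1 4] at b2
      rw [v3, hb 1 4] at b3
      rw [v4, hb 1 3] at b4
      linear_combination w 0 * hE - (pderiv 1 f * b1 - pderiv 2 f * b2 + pderiv 3 f * b3
        - pderiv 4 f * b4)
    · refine ⟨3 * w 1 + (pderiv 0 f * a 2 3 4 - pderiv 2 f * a 0 3 4 + pderiv 3 f * a 0 2 4
        - pderiv 4 f * a 0 2 3), ?_⟩
      have b1 := hab 2 3 4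
      have b2 := hab 0 3 4
      have b3 := hab 0 2 4
      have b4 := hab 0 2 3
      rw [v1, hb 2 4] at b1
      rw [v5, hb 0 4] at b2
      rw [v6, hb 0 4] at b3
      rw [v7, hb 0 3] at b4
      linear_combination w 1 * hE + (pderiv 0 f * b1 - pderiv 2 f * b2 + pderiv 3 f * b3
        - pderiv 4 f * b4)
  obtain ⟨g, hg⟩ := hdvd
  have h3 : (3 : MvPolynomial (Fin 5) ℂ) * C (1 / 3 : ℂ) = 1 := by
    rw [show (3 : MvPolynomial (Fin 5) ℂ) = C (3 : ℂ) from (map_ofNat C 3).symm, ← C_mul]; norm_num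
  refine ⟨fun i => w i - C (1 / 3 : ℂ) * g * X i, ?_, ?_⟩
  · rw [Fin.sum_univ_five] at hg ⊢
    linear_combination hg - C (1 / 3 : ℂ) * g * hE - f * g * h3
  · intro i j k
    change e i j k = Dd _ i j k
    set v : Fin 5 → MvPolynomial (Fin 5) ℂ := fun i => w i - C (1 / 3 : ℂ) * g * X i with hv
    have hz := alt_zero (fun i j k => e i j k - Dd v i j k)
      (fun i j k => by simp only [he1 i j k, Dd_alt1 v i j k]; ring)
      (fun i j k => by simp only [he2 i j k, Dd_alt2 v i j k]; ring)
      (by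
        obtain ⟨u1, u2, u3, u4, u5, u6, u7, u8, u9, u10⟩ :=
          Dg_vals v (fun i => (X i : MvPolynomial (Fin 5) ℂ))
        obtain ⟨v1, v2, v3, v4, v5, v6, v7, v8, v9, v10⟩ :=
          Dg_vals w (fun i => (X i : MvPolynomial (Fin 5) ℂ))
        have Q : ∀ i j : Fin 5, w i * X j - w j * X i = v i * X j - v j * X i := by
          intro i j
          simp only [hv]; ring
        have r1 := v1.trans (Eq.trans (Q 0 1) u1.symm)
        have r2 := v2.trans (Eq.trans (Q 2 0) u2.symm)
        have r3 := v3.trans (Eq.trans (Q 0 3) u3.symm)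
        have r4 := v4.trans (Eq.trans (Q 4 0) u4.symm)
        have r5 := v5.trans (Eq.trans (Q 1 2) u5.symm)
        have r6 := v6.trans (Eq.trans (Q 3 1) u6.symm)
        have r7 := v7.trans (Eq.trans (Q 1 4) u7.symm)
        have r8 := v8.trans (Eq.trans (Q 2 3) u8.symm)
        have r9 := v9.trans (Eq.trans (Q 4 2) u9.symm)
        have r10 := v10.trans (Eq.trans (Q 3 4) u10.symm)
        have R := forall_lt_cases
          (P := fun i j k => Dg w (fun i => X i) i j k = Dg v (fun i => X i) i j k)
          r1 r2 r3 r4 r5 r6 r7 r8 r9 r10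
        intro i j k hij hjk
        rw [hw i j k hij hjk, sub_eq_zero]
        exact R i j k hij hjk) i j k
    exact sub_eq_zero.mp hz
end
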